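/- Let p, n ∈ ℤ⁺ with n ≥ 2, let α ≥ 4 and K > 0, and let 1 ≤ s ≤ p. Suppose μ̂ = (μ̂_{m,s}(·;η)) is any family of sparse mean estimators satisfying Condition RSM for (α,K) with constants C₁, C₂ ≥ 1. Then for any ε ∈ (0,1) there exist constants C₃, C₄, C₅, C₆ > 0 depending only on α, K and ε such that the test φ^{RSM}_{P,sparse} with parameters a = C₃((p/s)^{1/α} + s^{−1/2}·log^{1/2}(log Δ̃₁)), r̃_t = C₄(s(p/s)^{2/α}·1{t=1} + √(s·log Δ̃₁)·1{t>1}), η_t = exp{s·log(ep/s) − min(t,Δ̃₂)/C₅}, r_t^{RSM} = C₆·min(t, Δ̃₂), Δ̃₁ = C₅(s·log(ep/s) + log(16/ε)) and Δ̃₂ = C₅(s·log(ep/s) + log(16·log(2n)/ε)) satisfies R_{P_{α,K}^⊗}(ρ, φ^{RSM}_{P,sparse}) ≤ ε whenever ρ² ≥ C₅·(s(p/s)^{2/α} + log log(8n)). -/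

import Mathlib

open MeasureTheory
open scoped Classical

namespace ChangePoint

noncomputable section

/-- The `i`-th column (0-based) of the data matrix, with out-of-range guard. -/
def col (p n : ℕ) (X : Fin n → Fin p → ℝ) (i : ℕ) : Fin p → ℝ :=
  if h : i < n then X ⟨i, h⟩ else 0

/-- ℓ₀-"norm": the number of nonzero coordinates. -/
def l0 (p : ℕ) (v : Fin p → ℝ) : ℕ :=
  (Finset.univ.filter fun j : Fin p => v j ≠ 0).card

/-- Squared Euclidean norm on `ℝ^p`. -/
def sqnorm (p : ℕ) (v : Fin p → ℝ) : ℝ := ∑ j, v j ^ 2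

/-- The iterated logarithm `log log (8 n)`. -/
def LL (n : ℕ) : ℝ := Real.log (Real.log (8 * n))

/-- The sub-Weibull class `𝒢_{α,K}` of distributions on `ℝ`:
mean `0`, variance `1` and `𝔼 exp (|W/K|^α) ≤ 2`. -/
def memG (α K : ℝ) (ν : Measure ℝ) : Prop :=
  IsProbabilityMeasure ν ∧ Integrable id ν ∧ (∫ x, x ∂ν) = 0 ∧
    (∫⁻ x, ENNReal.ofReal (x ^ 2) ∂ν) = 1 ∧
    (∫⁻ x, ENNReal.ofReal (Real.exp (|x / K| ^ α)) ∂ν) ≤ 2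

/-- The polynomially-tailed class `𝒫_{α,K}` of distributions on `ℝ`:
mean `0`, variance `1` and `𝔼 |W/K|^α ≤ 1`. -/
def memP (α K : ℝ) (ν : Measure ℝ) : Prop :=
  IsProbabilityMeasure ν ∧ Integrable id ν ∧ (∫ x, x ∂ν) = 0 ∧
    (∫⁻ x, ENNReal.ofReal (x ^ 2) ∂ν) = 1 ∧
    (∫⁻ x, ENNReal.ofReal (|x / K| ^ α) ∂ν) ≤ 1

/-- `P` is the joint law on `ℝ^{p×n}` of `p·n` independent entries with marginal laws `ν t j`
(characterised on measurable rectangles). -/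
def IsEntrywiseProduct (p n : ℕ) (P : Measure (Fin n → Fin p → ℝ))
    (ν : Fin n → Fin p → Measure ℝ) : Prop :=
  IsProbabilityMeasure P ∧
    ∀ s : Fin n → Fin p → Set ℝ, (∀ t j, MeasurableSet (s t j)) →
      P {x | ∀ t j, x t j ∈ s t j} = ∏ t, ∏ j, ν t j (s t j)

/-- The class `𝒢_{α,K}^⊗` of noise distributions. -/
def Gclass (p n : ℕ) (α K : ℝ) : Set (Measure (Fin n → Fin p → ℝ)) :=
  {P | ∃ ν : Fin n → Fin p → Measure ℝ, (∀ t j, memG α K (ν t j)) ∧ IsEntrywiseProduct p n P ν}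

/-- The class `𝒫_{α,K}^⊗` of noise distributions. -/
def Pclass (p n : ℕ) (α K : ℝ) : Set (Measure (Fin n → Fin p → ℝ)) :=
  {P | ∃ ν : Fin n → Fin p → Measure ℝ, (∀ t j, memP α K (ν t j)) ∧ IsEntrywiseProduct p n P ν}

/-- The null parameter space `Θ₀(p,n)`: constant signal. -/
def Theta0 (p n : ℕ) : Set (Fin n → Fin p → ℝ) :=
  {θ | ∃ μ : Fin p → ℝ, ∀ t, θ t = μ}

/-- `Θ^{(t₀)}(p,n,s,ρ)`: a single mean change at (1-based) time `t0` of sparsity `s` and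
normalized signal strength at least `ρ`. -/
def ThetaAt (p n t0 s : ℕ) (ρ : ℝ) : Set (Fin n → Fin p → ℝ) :=
  {θ | ∃ μ₁ μ₂ : Fin p → ℝ,
    (∀ t : Fin n, (t : ℕ) < t0 → θ t = μ₁) ∧
    (∀ t : Fin n, t0 ≤ (t : ℕ) → θ t = μ₂) ∧
    l0 p (fun j => μ₁ j - μ₂ j) ≤ s ∧
    ρ ^ 2 ≤ (t0 : ℝ) * ((n : ℝ) - (t0 : ℝ)) / (n : ℝ) * sqnorm p (fun j => μ₁ j - μ₂ j)}

/-- The single-change-point alternative `Θ(p,n,s,ρ)`. -/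
def Theta1 (p n s : ℕ) (ρ : ℝ) : Set (Fin n → Fin p → ℝ) :=
  ⋃ t0 ∈ Finset.Icc 1 (n - 1), ThetaAt p n t0 s ρ

/-- A (randomized-free) test: a measurable `{0,1}`-valued function of the data. -/
def IsTest (p n : ℕ) (φ : (Fin n → Fin p → ℝ) → ℝ) : Prop :=
  Measurable φ ∧ ∀ x, φ x = 0 ∨ φ x = 1

/-- The worst-case testing error of the test `φ` for null `Θ₀(p,n)` against the
alternative `Θalt`, over the noise class `Q`. -/
def risk (p n : ℕ) (Q : Set (Measure (Fin n → Fin p → ℝ)))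
    (Θalt : Set (Fin n → Fin p → ℝ)) (φ : (Fin n → Fin p → ℝ) → ℝ) : ℝ :=
  (⨆ P ∈ Q, ⨆ θ ∈ Theta0 p n, ∫ E, φ (θ + E) ∂P) +
  (⨆ P ∈ Q, ⨆ θ ∈ Θalt, ∫ E, (1 - φ (θ + E)) ∂P)

/-- The dyadic grid `𝒯 = {1,2,4,…,2^{⌊log₂(n/2)⌋}}`. -/
def Tgrid (n : ℕ) : Finset ℕ :=
  (Finset.range (Nat.log 2 (n / 2) + 1)).image fun k => 2 ^ k

/-- The CUSUM-type statistic `Y_t`. -/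
def Yt (p n : ℕ) (X : Fin n → Fin p → ℝ) (t : ℕ) (j : Fin p) : ℝ :=
  (∑ i ∈ Finset.range t, (col p n X i j - col p n X (n - 1 - i) j)) / Real.sqrt (2 * t)

/-- `A_t = ∑_j (Y_t(j)² − 1)`. -/
def At (p n : ℕ) (X : Fin n → Fin p → ℝ) (t : ℕ) : ℝ :=
  ∑ j, (Yt p n X t j ^ 2 - 1)

/-- The dense sub-Weibull test `φ_{𝒢,dense}` with threshold `r`. -/
def phiGdense (p n : ℕ) (r : ℝ) (X : Fin n → Fin p → ℝ) : ℝ :=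
  if ∃ t ∈ Tgrid n, r < At p n X t then 1 else 0

/-- Sample-splitting statistic `Y_{t,1}` (odd-indexed observations). -/
def Yt1 (p n : ℕ) (X : Fin n → Fin p → ℝ) (t : ℕ) (j : Fin p) : ℝ :=
  (∑ i ∈ Finset.range (t / 2), (col p n X (2 * i) j - col p n X (n - 1 - 2 * i) j)) /
    Real.sqrt t

/-- Sample-splitting statistic `Y_{t,2}` (even-indexed observations). -/
def Yt2 (p n : ℕ) (X : Fin n → Fin p → ℝ) (t : ℕ) (j : Fin p) : ℝ :=
  (∑ i ∈ Finset.range (t / 2), (col p n X (2 * i + 1) j - col p n X (n - 2 - 2 * i) j)) /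
    Real.sqrt t

/-- `Y_1 = (X_1 − X_n)/√2`. -/
def Y1 (p n : ℕ) (X : Fin n → Fin p → ℝ) (j : Fin p) : ℝ :=
  (col p n X 0 j - col p n X (n - 1) j) / Real.sqrt 2

/-- The hard-thresholded statistic `A_{t,a}`. -/
def Ata (p n : ℕ) (X : Fin n → Fin p → ℝ) (t : ℕ) (a : ℝ) : ℝ :=
  if t = 1 then ∑ j, (Y1 p n X j ^ 2 - 1) * (if a ≤ |Y1 p n X j| then 1 else 0)
  else ∑ j, (Yt1 p n X t j ^ 2 - 1) * (if a ≤ |Yt2 p n X t j| then 1 else 0)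

/-- The sparse sub-Weibull test `φ_{𝒢,sparse}` with threshold parameters `a, r, r₁`. -/
def phiGsparse (p n : ℕ) (a r r₁ : ℝ) (X : Fin n → Fin p → ℝ) : ℝ :=
  if (∃ t ∈ Tgrid n, t ≠ 1 ∧ r < Ata p n X t a) ∨ r₁ < Ata p n X 1 a then 1 else 0

/-- The median of a list of reals: its `⌈m/2⌉`-th smallest element. -/
def median (l : List ℝ) : ℝ :=
  (l.insertionSort (· ≤ ·)).getD ((l.length + 1) / 2 - 1) 0

/-- `Z_i = (X_i − X_{n+1−i})/√2` (0-based index `i`). -/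
def Zb (p n : ℕ) (X : Fin n → Fin p → ℝ) (i : ℕ) (j : Fin p) : ℝ :=
  (col p n X i j - col p n X (n - 1 - i) j) / Real.sqrt 2

/-- Mean of the `g`-th (0-based) of `G` consecutive equal-size groups of `Z_1,…,Z_t`. -/
def groupMean (p n : ℕ) (X : Fin n → Fin p → ℝ) (t G g : ℕ) (j : Fin p) : ℝ :=
  (∑ i ∈ Finset.range (t / G), Zb p n X (g * (t / G) + i) j) / ((t / G : ℕ) : ℝ)

/-- The median-of-means statistic `A_t^{MoM}` with `G` groups. -/
def AMoM (p n : ℕ) (X : Fin n → Fin p → ℝ) (t G : ℕ) : ℝ :=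
  (t : ℝ) * median (List.ofFn fun g : Fin G =>
    ∑ j, (groupMean p n X t G (g : ℕ) j ^ 2 - (G : ℝ) / (t : ℝ)))

/-- `Δ = 2^{3+⌈log₂ log log (8n)⌉}`. -/
def DeltaDense (n : ℕ) : ℕ := 2 ^ (3 + (Int.ceil (Real.logb 2 (LL n))).toNat)

/-- The dense median-of-means test `φ_{𝒫,dense}`. -/
def phiPdense (p n : ℕ) (α C₁ : ℝ) (X : Fin n → Fin p → ℝ) : ℝ :=
  if ∃ t ∈ Tgrid n,
      1 < AMoM p n X t (min t (DeltaDense n)) /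
        (C₁ * (p : ℝ) ^ max ((1 : ℝ) / 2) (2 / α) * ((min t (DeltaDense n) : ℕ) : ℝ))
  then 1 else 0

/-- `Δ = 2^{4+⌈log₂ log log (8n)⌉}`. -/
def DeltaSparse (n : ℕ) : ℕ := 2 ^ (4 + (Int.ceil (Real.logb 2 (LL n))).toNat)

/-- Mean of the `g`-th (0-based) of `G` consecutive equal-size groups of the odd-indexed
`Z_1, Z_3, …, Z_{t−1}`. -/
def groupMeanOdd (p n : ℕ) (X : Fin n → Fin p → ℝ) (t G g : ℕ) (j : Fin p) : ℝ :=
  (∑ i ∈ Finset.range (t / (2 * G)), Zb p n X (2 * (g * (t / (2 * G)) + i)) j) /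
    ((t / (2 * G) : ℕ) : ℝ)

/-- The hard-thresholded median-of-means statistic `A_{t,a}^{MoM}` with `G` groups. -/
def AMoMa (p n : ℕ) (X : Fin n → Fin p → ℝ) (t G : ℕ) (a : ℝ) : ℝ :=
  if t = 1 then ∑ j, (Zb p n X 0 j ^ 2 - 1) * (if a ≤ |Zb p n X 0 j| then 1 else 0)
  else ((t : ℝ) / 2) * median (List.ofFn fun g : Fin G =>
    ∑ j, (groupMeanOdd p n X t G (g : ℕ) j ^ 2 - 2 * (G : ℝ) / (t : ℝ)) *
      (if a ≤ |Yt2 p n X t j| then 1 else 0))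

/-- The sparse median-of-means test `φ_{𝒫,sparse}^{MoM}`. -/
def phiPsparseMoM (p n s : ℕ) (α C₁ C₂ : ℝ) (X : Fin n → Fin p → ℝ) : ℝ :=
  if ∃ t ∈ Tgrid n,
      1 < AMoMa p n X t (min t (DeltaSparse n) / 2)
            (C₁ * (((p : ℝ) / (s : ℝ)) ^ ((1 : ℝ) / α) +
              ((s : ℝ) ^ (-(1 : ℝ) / 2)) * Real.sqrt (LL n))) /
          (C₂ * (if t = 1 then (s : ℝ) * ((p : ℝ) / (s : ℝ)) ^ ((2 : ℝ) / α)
                 else Real.sqrt (s : ℝ) * ((min t (DeltaSparse n) / 2 : ℕ) : ℝ)))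
  then 1 else 0

/-- Condition RSM for `(α, K)` with constants `C₁, C₂`: statistical guarantee for a family
of (measurable) robust sparse mean estimators. -/
def CondRSM (p s : ℕ) (α K C₁ C₂ : ℝ)
    (est : (m : ℕ) → (Fin m → Fin p → ℝ) → ℝ → Fin p → ℝ) : Prop :=
  (∀ m : ℕ, Measurable fun Wη : (Fin m → Fin p → ℝ) × ℝ => est m Wη.1 Wη.2) ∧
  ∀ (m : ℕ) (μW : Fin p → ℝ) (ν : Fin m → Measure (Fin p → ℝ))
    (P : Measure (Fin m → Fin p → ℝ)) (η : ℝ),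
    0 < η → η < 1 → l0 p μW ≤ s →
    (∀ i, IsProbabilityMeasure (ν i)) →
    (∀ i j, Integrable (fun w => w j) (ν i) ∧ (∫ w, w j ∂ν i) = μW j) →
    (∀ i j k, Integrable (fun w => (w j - μW j) * (w k - μW k)) (ν i) ∧
      (∫ w, (w j - μW j) * (w k - μW k) ∂ν i) = if j = k then 1 else 0) →
    (∀ i j, (∫⁻ w, ENNReal.ofReal (|w j - μW j| ^ α) ∂ν i) ≤
      ENNReal.ofReal ((Real.sqrt 2 * K) ^ α)) →
    IsProbabilityMeasure P →
    (∀ S : Fin m → Set (Fin p → ℝ), (∀ i, MeasurableSet (S i)) →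
      P {W | ∀ i, W i ∈ S i} = ∏ i, ν i (S i)) →
    C₁ * ((s : ℝ) * Real.log (Real.exp 1 * (p : ℝ) / (s : ℝ)) + Real.log (1 / η)) ≤ (m : ℝ) →
    ENNReal.ofReal (1 - η) ≤
      P {W | Real.sqrt (sqnorm p fun j => est m W η j - μW j) ≤
        Real.sqrt C₂ * (Real.sqrt ((s : ℝ) * Real.log (Real.exp 1 * (p : ℝ) / (s : ℝ)) / (m : ℝ)) +
          Real.sqrt (Real.log (1 / η) / (m : ℝ)))}

/-- `Δ̃₁ = C₅ (s log(ep/s) + log(16/ε))`. -/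
def rsmDelta1 (p s : ℕ) (ε C₅ : ℝ) : ℝ :=
  C₅ * ((s : ℝ) * Real.log (Real.exp 1 * (p : ℝ) / (s : ℝ)) + Real.log (16 / ε))

/-- `Δ̃₂ = C₅ (s log(ep/s) + log(16 log(2n)/ε))`. -/
def rsmDelta2 (p s n : ℕ) (ε C₅ : ℝ) : ℝ :=
  C₅ * ((s : ℝ) * Real.log (Real.exp 1 * (p : ℝ) / (s : ℝ)) +
    Real.log (16 * Real.log (2 * (n : ℝ)) / ε))

/-- `a = C₃ ((p/s)^{1/α} + s^{−1/2} log^{1/2}(log Δ̃₁))`. -/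
def rsmA (p s : ℕ) (α ε C₃ C₅ : ℝ) : ℝ :=
  C₃ * (((p : ℝ) / (s : ℝ)) ^ ((1 : ℝ) / α) +
    ((s : ℝ) ^ (-(1 : ℝ) / 2)) * Real.sqrt (Real.log (Real.log (rsmDelta1 p s ε C₅))))

/-- The sparse test `φ^{RSM}_{𝒫,sparse}` built from a robust sparse mean estimator `est`. -/
def phiRSM (p n s : ℕ) (est : (m : ℕ) → (Fin m → Fin p → ℝ) → ℝ → Fin p → ℝ)
    (α ε C₃ C₄ C₅ C₆ : ℝ) (X : Fin n → Fin p → ℝ) : ℝ :=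
  if (∃ t ∈ Tgrid n, (t : ℝ) ≤ rsmDelta1 p s ε C₅ ∧
        1 < Ata p n X t (rsmA p s α ε C₃ C₅) /
          (C₄ * (if t = 1 then (s : ℝ) * ((p : ℝ) / (s : ℝ)) ^ ((2 : ℝ) / α)
                 else Real.sqrt ((s : ℝ) * Real.log (rsmDelta1 p s ε C₅))))) ∨
     (∃ t ∈ Tgrid n, rsmDelta1 p s ε C₅ < (t : ℝ) ∧
        1 < (t : ℝ) * sqnorm p (est t (fun i : Fin t => fun j => Zb p n X (i : ℕ) j)
              (Real.exp ((s : ℝ) * Real.log (Real.exp 1 * (p : ℝ) / (s : ℝ)) -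
                min (t : ℝ) (rsmDelta2 p s n ε C₅) / C₅))) /
          (C₆ * min (t : ℝ) (rsmDelta2 p s n ε C₅)))
  then 1 else 0

/-- The multiple-change-point alternative `Θ_multi(p,n,ρ)`. -/
def ThetaMulti (p n : ℕ) (ρ : ℝ) : Set (Fin n → Fin p → ℝ) :=
  {θ | ∃ k : ℕ, 1 ≤ k ∧ ∃ τ : ℕ → ℕ, ∃ μ : ℕ → Fin p → ℝ,
    τ 0 = 0 ∧ τ (k + 1) = n ∧ (∀ i ≤ k, τ i < τ (i + 1)) ∧
    (∀ i, 1 ≤ i → i ≤ k + 1 →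
      ∀ t : Fin n, τ (i - 1) ≤ (t : ℕ) → (t : ℕ) < τ i → θ t = μ i) ∧
    ∃ i, 1 ≤ i ∧ i ≤ k ∧
      4 * Real.log (n : ℝ) ≤ ((min (τ i - τ (i - 1)) (τ (i + 1) - τ i) : ℕ) : ℝ) ∧
      ρ ^ 2 ≤ sqnorm p (fun j => μ (i + 1) j - μ i j) *
        ((min (τ i - τ (i - 1)) (τ (i + 1) - τ i) : ℕ) : ℝ)}

/-- Membership in the temporal-dependence class `𝒫_Temp`: independent rows, entrywise
`𝒫_{α,K}` marginals, and exponentially decaying interlaced α-mixing coefficients. -/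
def memPTemp (p n : ℕ) (α K c₁ c₂ : ℝ) (P : Measure (Fin n → Fin p → ℝ)) : Prop :=
  IsProbabilityMeasure P ∧
  (∀ s : Fin p → Set (Fin n → ℝ), (∀ j, MeasurableSet (s j)) →
    P {x | ∀ j, (fun t => x t j) ∈ s j} = ∏ j, P {x | (fun t => x t j) ∈ s j}) ∧
  (∀ t j, memP α K (P.map fun x => x t j)) ∧
  (∀ i : ℕ, 1 ≤ i → i ≤ n - 1 →
    ∀ S T : Set (Fin n),
      (∀ s' ∈ S, ∀ t' ∈ T, (i : ℤ) ≤ |((s' : ℕ) : ℤ) - ((t' : ℕ) : ℤ)|) →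
      ∀ A B : Set (Fin n → Fin p → ℝ),
        MeasurableSet[MeasurableSpace.comap (fun x (t : S) => x t.1) inferInstance] A →
        MeasurableSet[MeasurableSpace.comap (fun x (t : T) => x t.1) inferInstance] B →
        |(P (A ∩ B)).toReal - (P A).toReal * (P B).toReal| ≤ c₁ * Real.exp (-c₂ * (i : ℝ)))

/-- The class `𝒲_α` of distributions on `ℝ^p`: centered with `𝔼|⟨W,v⟩|^α ≤ 1` for
every unit vector `v`. -/
def memW (p : ℕ) (α : ℝ) (ν : Measure (Fin p → ℝ)) : Prop :=
  IsProbabilityMeasure ν ∧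
  (∀ j, Integrable (fun w => w j) ν ∧ (∫ w, w j ∂ν) = 0) ∧
  ∀ v : Fin p → ℝ, sqnorm p v = 1 →
    (∫⁻ w, ENNReal.ofReal (|∑ j, w j * v j| ^ α) ∂ν) ≤ 1

/-- The class `𝒲_α^⊗`: independent columns with distributions in `𝒲_α`. -/
def Wclass (p n : ℕ) (α : ℝ) : Set (Measure (Fin n → Fin p → ℝ)) :=
  {P | ∃ ν : Fin n → Measure (Fin p → ℝ), (∀ t, memW p α (ν t)) ∧
    IsProbabilityMeasure P ∧
    ∀ s : Fin n → Set (Fin p → ℝ), (∀ t, MeasurableSet (s t)) →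
      P {x | ∀ t, x t ∈ s t} = ∏ t, ν t (s t)}

/-- The alternative `⋃_{t₀=1}^{n−1} Θ(p,n,ρ_{t₀})` for a location-dependent signal
strength sequence `ρ`. -/
def ThetaSeq (p n : ℕ) (ρ : ℕ → ℝ) : Set (Fin n → Fin p → ℝ) :=
  ⋃ t0 ∈ Finset.Icc 1 (n - 1),
    {θ | ∃ μ₁ μ₂ : Fin p → ℝ,
      (∀ t : Fin n, (t : ℕ) < t0 → θ t = μ₁) ∧
      (∀ t : Fin n, t0 ≤ (t : ℕ) → θ t = μ₂) ∧
      (ρ t0) ^ 2 ≤ sqnorm p (fun j => μ₁ j - μ₂ j)}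

/-- The boundary-restricted alternative `Θ_res(p,n,s,ρ)`. -/
def ThetaRes (p n s : ℕ) (ρ tres : ℝ) : Set (Fin n → Fin p → ℝ) :=
  {θ | ∃ t0 : ℕ, tres + 1 ≤ (t0 : ℝ) ∧ (t0 : ℝ) ≤ (n : ℝ) - tres ∧ θ ∈ ThetaAt p n t0 s ρ}

/-- `t^res = 32 (log (e² p / s) + s^{−1} log log (8n))`. -/
def tRes (p n s : ℕ) : ℝ :=
  32 * (Real.log (Real.exp 1 ^ 2 * (p : ℝ) / (s : ℝ)) + LL n / (s : ℝ))

end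

section Helpers

open ProbabilityTheory

section TruncatedMoments

/-- The constant in the second-order expansion of `|x + y| ^ α`. -/
noncomputable def taylorConst (α : ℝ) : ℝ := 2 ^ α + α + (Real.exp α + 1) * α ^ 2

lemma taylorConst_pos {α : ℝ} (hα : 0 ≤ α) : 0 < taylorConst α := by
  unfold taylorConst; positivity

lemma exp_le_one_add_add_sq {M v : ℝ} (hv : v ≤ M) :
    Real.exp v ≤ 1 + v + (Real.exp M + 1) * v ^ 2 := by
  rcases le_or_gt |v| 1 with h | h
  · have := (abs_le.1 (Real.abs_exp_sub_one_sub_id_le h)).2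
    have h2 : 0 ≤ Real.exp M * v ^ 2 := by positivity
    linarith
  · have h1 : (1 : ℝ) ≤ v ^ 2 := by
      have := sq_abs v; nlinarith
    have h2 : Real.exp v ≤ Real.exp M := Real.exp_le_exp.2 hv
    have h3 : Real.exp M ≤ Real.exp M * v ^ 2 := le_mul_of_one_le_right (Real.exp_pos _).le h1
    nlinarith [sq_nonneg (v + 1 / 2)]

lemma abs_add_rpow_le {α : ℝ} (hα : 2 ≤ α) (x y : ℝ) :
    |x + y| ^ α ≤ |x| ^ α + α * (|x| ^ (α - 2) * x * y) +
      taylorConst α * (|x| ^ (α - 2) * y ^ 2 + |y| ^ α) := by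
  have hα0 : 0 ≤ α := by linarith
  have hT : 0 ≤ |x| ^ (α - 2) * y ^ 2 := by positivity
  have hY : 0 ≤ |y| ^ α := by positivity
  unfold taylorConst
  rcases le_or_gt |x| |y| with h | h
  · have h1 : |x + y| ^ α ≤ 2 ^ α * |y| ^ α := by
      rw [← Real.mul_rpow (by norm_num) (abs_nonneg y)]
      exact Real.rpow_le_rpow (abs_nonneg _) (by linarith [abs_add_le x y]) hα0
    have h2 : -(|x| ^ (α - 2) * x * y) ≤ |y| ^ α := by
      have : |y| ^ α = |y| ^ (α - 2) * |y| * |y| := by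
        rcases eq_or_ne y 0 with rfl | hy
        · simp [show α ≠ 0 by linarith]
        · have : |y| ^ α = |y| ^ (α - 2) * |y| ^ (2 : ℝ) := by
            rw [← Real.rpow_add (abs_pos.2 hy)]; congr 1; ring
          rw [this]; norm_cast; ring
      rw [this]
      refine (neg_le_abs _).trans ?_
      rw [abs_mul, abs_mul, abs_of_nonneg (Real.rpow_nonneg (abs_nonneg x) _)]
      gcongr
    have h3 : 0 ≤ |x| ^ α := by positivity
    have h4 : 0 ≤ (Real.exp α + 1) * α ^ 2 := by positivity
    nlinarith [mul_nonneg h4 hY, mul_nonneg (add_nonneg (add_nonneg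
      (Real.rpow_nonneg (by norm_num : (0 : ℝ) ≤ 2) α) hα0) h4) hT,
      mul_le_mul_of_nonneg_left h2 hα0]
  · have hx : 0 < |x| := lt_of_le_of_lt (abs_nonneg y) h
    have hx0 : x ≠ 0 := abs_pos.1 hx
    set u : ℝ := y / x with hu
    have hu1 : |u| ≤ 1 := by
      rw [hu, abs_div, div_le_one hx]; exact h.le
    have hu2 := abs_le.1 hu1
    have hxy : |x + y| = |x| * (1 + u) := by
      have : x + y = x * (1 + u) := by rw [hu]; field_simp
      rw [this, abs_mul, abs_of_nonneg (by linarith : (0 : ℝ) ≤ 1 + u)]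
    have h1 : (1 + u) ^ α ≤ 1 + α * u + (Real.exp α + 1) * (α * u) ^ 2 := by
      calc (1 + u) ^ α ≤ (Real.exp u) ^ α :=
            Real.rpow_le_rpow (by linarith) (by linarith [Real.add_one_le_exp u]) hα0
        _ = Real.exp (α * u) := by rw [← Real.exp_mul]; ring_nf
        _ ≤ _ := exp_le_one_add_add_sq (by nlinarith)
    have hxx : |x| ^ α = |x| ^ (α - 2) * x ^ 2 := by
      have : |x| ^ α = |x| ^ (α - 2) * |x| ^ (2 : ℝ) := by
        rw [← Real.rpow_add hx]; congr 1; ring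
      rw [this]; norm_cast; rw [sq_abs]
    have h2 : |x + y| ^ α ≤ |x| ^ α + α * (|x| ^ (α - 2) * x * y) +
        (Real.exp α + 1) * α ^ 2 * (|x| ^ (α - 2) * y ^ 2) := by
      rw [hxy, Real.mul_rpow (abs_nonneg _) (by linarith)]
      have e1 : |x| ^ (α - 2) * x * y = |x| ^ α * u := by
        rw [hxx, hu]; field_simp
      have e2 : |x| ^ (α - 2) * y ^ 2 = |x| ^ α * u ^ 2 := by
        rw [hxx, hu]; field_simp
      rw [e1, e2]
      have := mul_le_mul_of_nonneg_left h1 (Real.rpow_nonneg (abs_nonneg x) α)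
      nlinarith
    have h5 : 0 ≤ 2 ^ α + α := by positivity
    have h6 : 0 ≤ (Real.exp α + 1) * α ^ 2 := by positivity
    nlinarith [mul_nonneg h5 hT, mul_nonneg (add_nonneg h5 h6) hY]

variable {Ω ι : Type*} [MeasurableSpace Ω] {P : Measure Ω}

lemma rpow_le_one_add_rpow {β α x : ℝ} (hβ : 0 ≤ β) (h : β ≤ α) (hx : 0 ≤ x) :
    x ^ β ≤ 1 + x ^ α := by
  rcases le_or_gt x 1 with h1 | h1
  · linarith [Real.rpow_le_one hx h1 hβ, Real.rpow_nonneg hx α]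
  · linarith [Real.rpow_le_rpow_of_exponent_le h1.le h]

lemma memLp_ofReal_iff {α : ℝ} (hα : 0 < α) {f : Ω → ℝ} (hf : Measurable f) :
    MemLp f (ENNReal.ofReal α) P ↔ Integrable (fun ω => |f ω| ^ α) P := by
  have := integrable_norm_rpow_iff (μ := P) (f := f) (p := ENNReal.ofReal α)
    hf.aestronglyMeasurable (by simp [hα]) (by simp)
  rw [ENNReal.toReal_ofReal hα.le] at this
  simpa using this.symm

/-- A Marcinkiewicz–Zygmund/Rosenthal-type moment bound for sums of independent centred
variables with small second and `α`-th moments. -/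
lemma moment_sum_le [IsProbabilityMeasure P] {α τ B : ℝ} (hα : 2 ≤ α) (hτ : 0 ≤ τ)
    {f : ι → Ω → ℝ} (hf : ∀ i, Measurable (f i)) (hind : iIndepFun f P) (s : Finset ι)
    (hLp : ∀ i ∈ s, Integrable (fun ω => |f i ω| ^ α) P)
    (h0 : ∀ i ∈ s, ∫ ω, f i ω ∂P = 0)
    (h2 : ∀ i ∈ s, ∫ ω, f i ω ^ 2 ∂P ≤ τ)
    (hM : ∀ i ∈ s, ∫ ω, |f i ω| ^ α ∂P ≤ B * τ) :
    Integrable (fun ω => |∑ i ∈ s, f i ω| ^ α) P ∧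
      ∫ ω, |∑ i ∈ s, f i ω| ^ α ∂P + (1 + B) ≤ (1 + taylorConst α * τ) ^ s.card * (1 + B) := by
  classical
  have hα0 : 0 < α := by linarith
  have hC := (taylorConst_pos hα0.le).le
  induction s using Finset.induction_on with
  | empty => simp [hα0.ne']
  | insert a s ha ih =>
    obtain ⟨ihI, ih⟩ := ih (fun i hi => hLp i (Finset.mem_insert_of_mem hi))
      (fun i hi => h0 i (Finset.mem_insert_of_mem hi))
      (fun i hi => h2 i (Finset.mem_insert_of_mem hi))
      (fun i hi => hM i (Finset.mem_insert_of_mem hi))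
    have hLa := hLp a (Finset.mem_insert_self a s)
    have h0a := h0 a (Finset.mem_insert_self a s)
    have h2a := h2 a (Finset.mem_insert_self a s)
    have hMa := hM a (Finset.mem_insert_self a s)
    set S : Ω → ℝ := fun ω => ∑ i ∈ s, f i ω with hS
    have hSm : Measurable S := by fun_prop
    have hi : IndepFun S (f a) P := by
      have := hind.indepFun_finsetSum_of_notMem hf ha
      convert this using 1
      ext ω; simp [hS]
    have hone : (1 : ENNReal) ≤ ENNReal.ofReal α := by
      rw [← ENNReal.ofReal_one]; exact ENNReal.ofReal_le_ofReal (by linarith)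
    have htwo : (2 : ENNReal) ≤ ENNReal.ofReal α := by
      rw [show (2 : ENNReal) = ENNReal.ofReal 2 by simp]; exact ENNReal.ofReal_le_ofReal hα
    have hS_Lp : MemLp S (ENNReal.ofReal α) P := (memLp_ofReal_iff hα0 hSm).2 ihI
    have hfa_Lp : MemLp (f a) (ENNReal.ofReal α) P := (memLp_ofReal_iff hα0 (hf a)).2 hLa
    have hfa1 : Integrable (f a) P := hfa_Lp.integrable hone
    have hfa2 : Integrable (fun ω => f a ω ^ 2) P := (hfa_Lp.mono_exponent htwo).integrable_sq
    have hgI : Integrable (fun ω => |S ω| ^ (α - 2)) P := by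
      refine Integrable.mono' ((integrable_const 1).add ihI)
        (Measurable.aestronglyMeasurable (by fun_prop)) (ae_of_all _ fun ω => ?_)
      rw [Real.norm_of_nonneg (by positivity)]
      exact rpow_le_one_add_rpow (by linarith) (by linarith) (abs_nonneg _)
    have hhI : Integrable (fun ω => |S ω| ^ (α - 2) * S ω) P := by
      refine Integrable.mono' ((integrable_const 1).add ihI)
        (Measurable.aestronglyMeasurable (by fun_prop)) (ae_of_all _ fun ω => ?_)
      rw [Real.norm_eq_abs, abs_mul, abs_of_nonneg (by positivity : 0 ≤ |S ω| ^ (α - 2))]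
      have : |S ω| ^ (α - 2) * |S ω| = |S ω| ^ (α - 1) := by
        rcases eq_or_ne (S ω) 0 with h | h
        · rw [h]; simp [show α - 1 ≠ 0 by linarith]
        · nth_rewrite 2 [← Real.rpow_one |S ω|]
          rw [← Real.rpow_add (abs_pos.2 h)]; congr 1; ring
      rw [this]
      exact rpow_le_one_add_rpow (by linarith) (by linarith) (abs_nonneg _)
    have i1 : IndepFun (fun ω => |S ω| ^ (α - 2) * S ω) (f a) P :=
      hi.comp (φ := fun x => |x| ^ (α - 2) * x) (ψ := id) (by fun_prop) measurable_id
    have i2 : IndepFun (fun ω => |S ω| ^ (α - 2)) (fun ω => f a ω ^ 2) P :=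
      hi.comp (φ := fun x => |x| ^ (α - 2)) (ψ := fun x => x ^ 2) (by fun_prop) (by fun_prop)
    have I1 := i1.integrable_mul hhI hfa1
    have I2 := i2.integrable_mul hgI hfa2
    have E1 := i1.integral_mul_eq_mul_integral hhI.aestronglyMeasurable hfa1.aestronglyMeasurable
    have E2 := i2.integral_mul_eq_mul_integral hgI.aestronglyMeasurable hfa2.aestronglyMeasurable
    simp only [Pi.mul_def] at I1 I2 E1 E2
    have hsum : ∀ ω, ∑ i ∈ insert a s, f i ω = S ω + f a ω := fun ω => by
      rw [Finset.sum_insert ha, add_comm]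
    simp only [hsum]
    have hInew : Integrable (fun ω => |S ω + f a ω| ^ α) P :=
      (memLp_ofReal_iff hα0 (hSm.add (hf a))).1 (hS_Lp.add hfa_Lp)
    refine ⟨hInew, ?_⟩
    have J1 : Integrable (fun ω => |S ω| ^ α + α * (|S ω| ^ (α - 2) * S ω * f a ω)) P :=
      ihI.add (I1.const_mul α)
    have J2 : Integrable (fun ω =>
        taylorConst α * (|S ω| ^ (α - 2) * f a ω ^ 2 + |f a ω| ^ α)) P := (I2.add hLa).const_mul _
    have step : ∫ ω, |S ω + f a ω| ^ α ∂P ≤ ∫ ω, (|S ω| ^ α + α * (|S ω| ^ (α - 2) * S ω * f a ω) +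
        taylorConst α * (|S ω| ^ (α - 2) * f a ω ^ 2 + |f a ω| ^ α)) ∂P :=
      integral_mono hInew (J1.add J2)
        (fun ω => abs_add_rpow_le hα (S ω) (f a ω))
    rw [integral_add J1 J2,
      integral_add ihI (I1.const_mul α), integral_const_mul, integral_const_mul,
      integral_add I2 hLa, E1, E2, h0a] at step
    have hg1 : ∫ ω, |S ω| ^ (α - 2) ∂P ≤ 1 + ∫ ω, |S ω| ^ α ∂P := by
      have := integral_mono hgI ((integrable_const 1).add ihI)
        (fun ω => rpow_le_one_add_rpow (by linarith) (by linarith : α - 2 ≤ α) (abs_nonneg (S ω)))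
      simp only [Pi.add_apply] at this
      rw [integral_add (integrable_const _) ihI] at this
      simpa using this
    have hg0 : 0 ≤ ∫ ω, |S ω| ^ (α - 2) ∂P := integral_nonneg fun ω => by positivity
    have key : (∫ ω, |S ω| ^ (α - 2) ∂P) * (∫ ω, f a ω ^ 2 ∂P) + ∫ ω, |f a ω| ^ α ∂P ≤
        τ * (∫ ω, |S ω| ^ α ∂P + (1 + B)) := by
      have := mul_le_mul hg1 h2a (integral_nonneg fun ω => by positivity) (by linarith)
      nlinarith
    have key2 := mul_le_mul_of_nonneg_left key hC
    rw [Finset.card_insert_of_notMem ha, pow_succ]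
    have := mul_le_mul_of_nonneg_left ih (by positivity : 0 ≤ 1 + taylorConst α * τ)
    nlinarith

end TruncatedMoments

section Grouping

variable {Ω ι : Type*} [MeasurableSpace Ω] {P : Measure Ω}

/-- Functions of disjoint blocks of independent real variables are independent. -/
lemma indepFun_of_disjoint_blocks {f : ι → Ω → ℝ} (hf : ∀ i, Measurable (f i))
    (hind : iIndepFun f P) {γ δ : Type*} [MeasurableSpace γ] [MeasurableSpace δ]
    {S T : Finset ι} (hST : Disjoint S T) {g : (ι → ℝ) → γ} {h : (ι → ℝ) → δ}
    (hg : Measurable g) (hh : Measurable h)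
    (hgS : ∀ x y, (∀ i ∈ S, x i = y i) → g x = g y)
    (hhT : ∀ x y, (∀ i ∈ T, x i = y i) → h x = h y) :
    IndepFun (fun ω => g fun i => f i ω) (fun ω => h fun i => f i ω) P := by
  classical
  have hm : ∀ U : Finset ι, Measurable fun (x : U → ℝ) (i : ι) =>
      if hi : i ∈ U then x ⟨i, hi⟩ else 0 := by
    intro U
    refine measurable_pi_lambda _ fun i => ?_
    by_cases hi : i ∈ U <;> simp only [hi, dite_true, dite_false] <;> fun_prop
  have key := (hind.indepFun_finset S T hST hf).comp (hg.comp (hm S)) (hh.comp (hm T))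
  have e1 : (fun ω => g fun i => f i ω) = (g ∘ fun (x : S → ℝ) (i : ι) =>
      if hi : i ∈ S then x ⟨i, hi⟩ else 0) ∘ fun a (i : S) => f i a := by
    funext ω
    exact hgS _ _ fun i hi => by simp [hi]
  have e2 : (fun ω => h fun i => f i ω) = (h ∘ fun (x : T → ℝ) (i : ι) =>
      if hi : i ∈ T then x ⟨i, hi⟩ else 0) ∘ fun a (i : T) => f i a := by
    funext ω
    exact hhT _ _ fun i hi => by simp [hi]
  rw [e1, e2]
  exact key

/-- Functions of pairwise disjoint blocks of independent real variables are mutually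
independent. -/
lemma iIndepFun_of_disjoint_blocks {f : ι → Ω → ℝ} (hf : ∀ i, Measurable (f i))
    (hind : iIndepFun f P) {κ : Type*} {γ : κ → Type*} [∀ k, MeasurableSpace (γ k)]
    {S : κ → Finset ι} (hS : ∀ k l, k ≠ l → Disjoint (S k) (S l))
    {g : ∀ k, (ι → ℝ) → γ k} (hg : ∀ k, Measurable (g k))
    (hgS : ∀ k x y, (∀ i ∈ S k, x i = y i) → g k x = g k y) :
    iIndepFun (fun k ω => g k fun i => f i ω) P := by
  classical
  have := hind.isProbabilityMeasure
  rw [iIndepFun_iff_measure_inter_preimage_eq_mul]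
  intro F sets hsets
  induction F using Finset.induction_on with
  | empty => simp
  | insert a F ha ih =>
    rw [Finset.prod_insert ha, ← ih fun i hi => hsets i (Finset.mem_insert_of_mem hi),
      Finset.set_biInter_insert]
    have hdisj : Disjoint (S a) (F.biUnion S) := by
      rw [Finset.disjoint_biUnion_right]
      exact fun k hk => hS a k fun h => ha (h ▸ hk)
    have hmeas : MeasurableSet (⋂ k ∈ F, g k ⁻¹' sets k) :=
      Finset.measurableSet_biInter _ fun k hk =>
        hg k (hsets k (Finset.mem_insert_of_mem hk))
    have h := indepFun_of_disjoint_blocks hf hind hdisj (hg a)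
      (h := fun x => x ∈ ⋂ k ∈ F, g k ⁻¹' sets k) (measurableSet_setOfPred.1 hmeas) (hgS a) (by
        intro x y hxy
        simp only [Set.mem_iInter, Set.mem_preimage, eq_iff_iff]
        refine forall₂_congr fun k hk => ?_
        rw [hgS k x y fun i hi => hxy i (Finset.mem_biUnion.2 ⟨k, hk, hi⟩)])
    have h2 := h.measure_inter_preimage_eq_mul _ _ (hsets a (Finset.mem_insert_self a F))
      (measurableSet_singleton True)
    convert h2 using 2
    · congr 1
      ext ω; simp
    · congr 1
      ext ω; simp

end Grouping

/-- A finite array of independent real random variables with mean zero, unit variance and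
absolute `α`-th moment at most `B`. -/
structure IsNoiseArray {Ω ι : Type*} [MeasurableSpace Ω] (P : Measure Ω) (ζ : ι → Ω → ℝ)
    (α B : ℝ) : Prop where
  measurable : ∀ q, Measurable (ζ q)
  indep : iIndepFun ζ P
  integrable_rpow : ∀ q, Integrable (fun ω => |ζ q ω| ^ α) P
  integral_eq_zero : ∀ q, ∫ ω, ζ q ω ∂P = 0
  integral_sq : ∀ q, ∫ ω, ζ q ω ^ 2 ∂P = 1
  integral_rpow_le : ∀ q, ∫ ω, |ζ q ω| ^ α ∂P ≤ B

/-- The normalised sum of the `j`-th coordinates over the block `A` of observations. -/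
noncomputable def blockSum {Ω : Type*} {m p : ℕ} (ζ : Fin m × Fin p → Ω → ℝ) (A : Finset (Fin m))
    (j : Fin p) (ω : Ω) : ℝ :=
  (∑ k ∈ A, ζ (k, j) ω) / Real.sqrt A.card

/-- The bound on the `α`-th moment of normalised block sums. -/
noncomputable def momentBound (α B : ℝ) : ℝ := Real.exp (taylorConst α) * (1 + B)

section Block

variable {Ω : Type*} [MeasurableSpace Ω] {P : Measure Ω}

variable {m p : ℕ} {ζ : Fin m × Fin p → Ω → ℝ} {α B : ℝ}

lemma IsNoiseArray.memLp {ι : Type*} {ζ : ι → Ω → ℝ} (h : IsNoiseArray P ζ α B) (hα : 0 < α)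
    (q : ι) : MemLp (ζ q) (ENNReal.ofReal α) P :=
  (memLp_ofReal_iff hα (h.measurable q)).2 (h.integrable_rpow q)

lemma measurable_blockSum (h : IsNoiseArray P ζ α B) (A : Finset (Fin m)) (j : Fin p) :
    Measurable (blockSum ζ A j) := by
  have := h.measurable
  unfold blockSum
  fun_prop

lemma moment_nonneg {ι : Type*} {ζ : ι → Ω → ℝ} (h : IsNoiseArray P ζ α B) (q : ι) : 0 ≤ B :=
  (integral_nonneg fun ω => by positivity).trans (h.integral_rpow_le q)

variable [IsProbabilityMeasure P]

lemma measure_ge_le_integral_div {f : Ω → ℝ} (hf0 : ∀ ω, 0 ≤ f ω) (hfi : Integrable f P)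
    {r : ℝ} (hr : 0 < r) : P {ω | r ≤ f ω} ≤ ENNReal.ofReal ((∫ ω, f ω ∂P) / r) := by
  have h := mul_meas_ge_le_integral_of_nonneg (ae_of_all P hf0) hfi r
  rw [ENNReal.le_ofReal_iff_toReal_le (measure_ne_top _ _)
    (div_nonneg (integral_nonneg hf0) hr.le), le_div_iff₀ hr, mul_comm]
  exact h

lemma IsNoiseArray.memLp_two {ι : Type*} {ζ : ι → Ω → ℝ} (h : IsNoiseArray P ζ α B) (hα : 2 ≤ α)
    (q : ι) : MemLp (ζ q) 2 P := by
  refine (h.memLp (by linarith) q).mono_exponent ?_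
  rw [show (2 : ENNReal) = ENNReal.ofReal 2 by simp]
  exact ENNReal.ofReal_le_ofReal hα

lemma blockSum_rpow (h : IsNoiseArray P ζ α B) (hα : 2 ≤ α) {A : Finset (Fin m)}
    (hA : A.Nonempty) (j : Fin p) :
    Integrable (fun ω => |blockSum ζ A j ω| ^ α) P ∧
      ∫ ω, |blockSum ζ A j ω| ^ α ∂P ≤ momentBound α B := by
  have hα0 : 0 < α := by linarith
  have hc : (1 : ℝ) ≤ A.card := by exact_mod_cast hA.card_pos
  set c : ℝ := Real.sqrt A.card with hcdef
  have hc1 : 1 ≤ c := Real.one_le_sqrt.2 hc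
  have hcsq : c ^ 2 = A.card := Real.sq_sqrt (by positivity)
  have hB : 0 ≤ B := by
    obtain ⟨k, -⟩ := hA
    exact moment_nonneg h (k, j)
  have hrw : ∀ (k : Fin m) ω, |ζ (k, j) ω / c| ^ α = |ζ (k, j) ω| ^ α / c ^ α := fun k ω => by
    rw [abs_div, Real.div_rpow (abs_nonneg _) (abs_nonneg _), abs_of_nonneg (by linarith : 0 ≤ c)]
  have hind : iIndepFun (fun (k : Fin m) ω => ζ (k, j) ω / c) P :=
    (h.indep.precomp (g := fun k : Fin m => (k, j)) (fun a b hab => (Prod.mk.inj hab).1)).comp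
      (fun _ x => x / c) (fun _ => by fun_prop)
  have hm := h.measurable
  have := moment_sum_le (P := P) (τ := 1 / (A.card : ℝ)) (B := B) hα (by positivity)
    (f := fun (k : Fin m) ω => ζ (k, j) ω / c) (fun k => by fun_prop) hind A
    (fun k _ => by
      simp only [hrw]
      exact (h.integrable_rpow (k, j)).div_const _)
    (fun k _ => by rw [integral_div, h.integral_eq_zero, zero_div])
    (fun k _ => by simp only [div_pow]; rw [integral_div, h.integral_sq, hcsq])
    (fun k _ => by
      simp only [hrw]
      rw [integral_div, ← hcsq, ← div_eq_mul_one_div]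
      have : c ^ 2 ≤ c ^ α := by
        rw [← Real.rpow_natCast]; exact Real.rpow_le_rpow_of_exponent_le hc1 (by simpa using hα)
      gcongr
      exact h.integral_rpow_le _)
  have hsum : ∀ ω, ∑ k ∈ A, ζ (k, j) ω / c = blockSum ζ A j ω := fun ω => by
    rw [blockSum, Finset.sum_div]
  simp only [hsum] at this
  refine ⟨this.1, ?_⟩
  have h2 : (1 + taylorConst α * (1 / (A.card : ℝ))) ^ A.card ≤ Real.exp (taylorConst α) := by
    have hT := (taylorConst_pos hα0.le).le
    calc (1 + taylorConst α * (1 / (A.card : ℝ))) ^ A.card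
        ≤ Real.exp (taylorConst α * (1 / (A.card : ℝ))) ^ A.card := by
          gcongr; linarith [Real.add_one_le_exp (taylorConst α * (1 / (A.card : ℝ)))]
      _ = Real.exp (taylorConst α) := by
          rw [← Real.exp_nat_mul]; congr 1; field_simp
  have h3 := mul_le_mul_of_nonneg_right h2 (by linarith : 0 ≤ 1 + B)
  unfold momentBound
  linarith [this.2]

lemma blockSum_memLp_two (h : IsNoiseArray P ζ α B) (hα : 2 ≤ α) (A : Finset (Fin m))
    (j : Fin p) : MemLp (blockSum ζ A j) 2 P := by
  have : MemLp (fun ω => (∑ k ∈ A, ζ (k, j) ω) * (Real.sqrt A.card)⁻¹) 2 P :=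
    (memLp_finsetSum A fun k _ => h.memLp_two hα (k, j)).mul_const _
  exact this

lemma integral_blockSum_sq (h : IsNoiseArray P ζ α B) (hα : 2 ≤ α) {A : Finset (Fin m)}
    (hA : A.Nonempty) (j : Fin p) : ∫ ω, blockSum ζ A j ω ^ 2 ∂P = 1 := by
  have hc : (0 : ℝ) < A.card := by exact_mod_cast hA.card_pos
  have hL := fun k : Fin m => h.memLp_two hα (k, j)
  have hmean : ∫ ω, (∑ k ∈ A, ζ (k, j)) ω ∂P = 0 := by
    simp only [Finset.sum_apply]
    rw [integral_finsetSum _ fun k _ => (hL k).integrable (by norm_num)]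
    exact Finset.sum_eq_zero fun k _ => h.integral_eq_zero _
  have hvar := IndepFun.variance_sum (μ := P) (X := fun k : Fin m => ζ (k, j)) (s := A)
    (fun k _ => hL k) (fun k _ l _ hkl => h.indep.indepFun (by simpa using hkl))
  have hv1 : ∀ k : Fin m, variance (ζ (k, j)) P = 1 := fun k => by
    rw [variance_of_integral_eq_zero (h.measurable _).aemeasurable (h.integral_eq_zero _),
      h.integral_sq]
  have hm := h.measurable
  rw [variance_of_integral_eq_zero (by fun_prop) hmean, Finset.sum_congr rfl fun k _ => hv1 k]
    at hvar
  simp only [blockSum, div_pow, Real.sq_sqrt hc.le]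
  rw [integral_div]
  simp only [Finset.sum_apply] at hvar
  rw [hvar]
  simp [hc.ne']

end Block

section Threshold

variable {Ω : Type*} [MeasurableSpace Ω] {P : Measure Ω}
  {m p : ℕ} {ζ : Fin m × Fin p → Ω → ℝ} {α B : ℝ}

lemma measurable_blockFun (A : Finset (Fin m)) (j : Fin p) :
    Measurable fun x : Fin m × Fin p → ℝ => (∑ k ∈ A, x (k, j)) / Real.sqrt A.card := by
  fun_prop

lemma indepFun_blockSum (h : IsNoiseArray P ζ α B) {A A' : Finset (Fin m)} (hA : Disjoint A A')
    (j : Fin p) : IndepFun (blockSum ζ A j) (blockSum ζ A' j) P := by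
  refine indepFun_of_disjoint_blocks h.measurable h.indep (S := A ×ˢ {j}) (T := A' ×ˢ {j})
    (Finset.disjoint_product.2 (Or.inl hA)) (measurable_blockFun A j) (measurable_blockFun A' j)
    (fun x y hxy => ?_) (fun x y hxy => ?_)
  · rw [Finset.sum_congr rfl fun k hk => hxy (k, j) (by simpa using hk)]
  · rw [Finset.sum_congr rfl fun k hk => hxy (k, j) (by simpa using hk)]

variable [IsProbabilityMeasure P]

lemma measure_sum_blockSum_sq_ge_le (h : IsNoiseArray P ζ α B) (hα : 2 ≤ α) {A : Finset (Fin m)}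
    (hA : A.Nonempty) (J : Finset (Fin p)) {r : ℝ} (hr : 0 < r) :
    P {ω | r ≤ ∑ j ∈ J, blockSum ζ A j ω ^ 2} ≤ ENNReal.ofReal (J.card / r) := by
  have hI : ∀ j ∈ J, Integrable (fun ω => blockSum ζ A j ω ^ 2) P := fun j _ =>
    (blockSum_memLp_two h hα A j).integrable_sq
  have := measure_ge_le_integral_div (P := P) (f := fun ω => ∑ j ∈ J, blockSum ζ A j ω ^ 2)
    (fun ω => Finset.sum_nonneg fun j _ => sq_nonneg _) (integrable_finsetSum _ hI) hr
  rwa [integral_finsetSum _ hI, Finset.sum_congr rfl fun j _ => integral_blockSum_sq h hα hA j,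
    Finset.sum_const, nsmul_eq_mul, mul_one] at this

lemma measure_selfThreshold_ge_le (h : IsNoiseArray P ζ α B) (hα : 2 ≤ α) {A : Finset (Fin m)}
    (hA : A.Nonempty) {a r : ℝ} (ha : 0 < a) (hr : 0 < r) :
    P {ω | r ≤ ∑ j, (blockSum ζ A j ω ^ 2 - 1) * (if a ≤ |blockSum ζ A j ω| then 1 else 0)} ≤
      ENNReal.ofReal (p * (momentBound α B * a ^ (2 - α)) / r) := by
  have hpt : ∀ y : ℝ, (y ^ 2 - 1) * (if a ≤ |y| then 1 else 0) ≤ |y| ^ α * a ^ (2 - α) := by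
    intro y
    split_ifs with hy
    · have hy0 : 0 < |y| := ha.trans_le hy
      have h1 : y ^ 2 = |y| ^ α * |y| ^ (2 - α) := by
        rw [← Real.rpow_add hy0, show α + (2 - α) = 2 by ring]; norm_cast; rw [sq_abs]
      have h2 : |y| ^ (2 - α) ≤ a ^ (2 - α) :=
        Real.rpow_le_rpow_of_nonpos ha hy (by linarith)
      have h3 := mul_le_mul_of_nonneg_left h2 (Real.rpow_nonneg (abs_nonneg y) α)
      linarith
    · rw [mul_zero]; positivity
  have hI : ∀ j ∈ (Finset.univ : Finset (Fin p)),
      Integrable (fun ω => |blockSum ζ A j ω| ^ α * a ^ (2 - α)) P := fun j _ =>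
    (blockSum_rpow h hα hA j).1.mul_const _
  have := measure_ge_le_integral_div (P := P)
    (f := fun ω => ∑ j, |blockSum ζ A j ω| ^ α * a ^ (2 - α))
    (fun ω => Finset.sum_nonneg fun j _ => by positivity) (integrable_finsetSum _ hI) hr
  refine (measure_mono fun ω hω => le_trans (α := ℝ) hω
    (Finset.sum_le_sum fun j _ => hpt _)).trans (this.trans (ENNReal.ofReal_le_ofReal ?_))
  rw [integral_finsetSum _ hI]
  gcongr
  calc ∑ j, ∫ ω, |blockSum ζ A j ω| ^ α * a ^ (2 - α) ∂P
      ≤ ∑ _j : Fin p, momentBound α B * a ^ (2 - α) := by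
        refine Finset.sum_le_sum fun j _ => ?_
        rw [integral_mul_const]
        gcongr
        exact (blockSum_rpow h hα hA j).2
    _ = _ := by simp

lemma measure_crossThreshold_ge_le (h : IsNoiseArray P ζ α B) (hα : 4 ≤ α)
    {A A' : Finset (Fin m)} (hA : A.Nonempty) (hA' : A'.Nonempty) (hAA : Disjoint A A')
    (J : Finset (Fin p)) {a r : ℝ} (ha : 0 < a) (hr : 0 < r) :
    P {ω | r ≤ |∑ j ∈ J, (blockSum ζ A j ω ^ 2 - 1) *
        (if a ≤ |blockSum ζ A' j ω| then 1 else 0)|} ≤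
      ENNReal.ofReal (J.card * (momentBound α B * (momentBound α B / a ^ α)) / r ^ 2) := by
  have hα2 : 2 ≤ α := by linarith
  set M := momentBound α B with hM
  let ψ : ℝ → ℝ := fun y => if a ≤ |y| then 1 else 0
  have hψm : Measurable ψ :=
    Measurable.ite (measurableSet_le measurable_const (by fun_prop)) measurable_const
      measurable_const
  have hψ0 : ∀ y, 0 ≤ ψ y := fun y => by simp only [ψ]; split_ifs <;> norm_num
  have hψ1 : ∀ y, ψ y ≤ 1 := fun y => by simp only [ψ]; split_ifs <;> norm_num
  have hψsq : ∀ y, ψ y ^ 2 = ψ y := fun y => by simp only [ψ]; split_ifs <;> norm_num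
  have hψle : ∀ y, ψ y ≤ |y| ^ α / a ^ α := fun y => by
    simp only [ψ]; split_ifs with hy
    · rw [le_div_iff₀ (by positivity), one_mul]
      exact Real.rpow_le_rpow ha.le hy (by linarith)
    · positivity
  set ξ : Fin p → Ω → ℝ := fun j ω => (blockSum ζ A j ω ^ 2 - 1) * ψ (blockSum ζ A' j ω) with hξ
  have hWm := fun j => measurable_blockSum h A j
  have hWm' := fun j => measurable_blockSum h A' j
  have hξm : ∀ j, Measurable (ξ j) := fun j =>
    (((hWm j).pow_const 2).sub_const 1).mul (hψm.comp (hWm' j))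
  have hWI := fun j => (blockSum_rpow h hα2 hA j)
  have hWI' := fun j => (blockSum_rpow h hα2 hA' j)
  have hW2 := fun j => (blockSum_memLp_two h hα2 A j).integrable_sq
  have hpt : ∀ y : ℝ, (y ^ 2 - 1) ^ 2 ≤ 2 - 2 * y ^ 2 + |y| ^ α := fun y => by
    have := rpow_le_one_add_rpow (β := 4) (by norm_num) hα (abs_nonneg y)
    have e : |y| ^ (4 : ℝ) = y ^ 4 := by
      rw [show (4 : ℝ) = ((4 : ℕ) : ℝ) by norm_num, Real.rpow_natCast]
      exact Even.pow_abs (by decide) y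
    rw [e] at this
    nlinarith
  have hcI : ∀ j, Integrable (fun ω => 2 - 2 * blockSum ζ A j ω ^ 2) P :=
    fun j => (integrable_const 2).sub ((hW2 j).const_mul 2)
  have hbI : ∀ j, Integrable (fun ω => 2 - 2 * blockSum ζ A j ω ^ 2 + |blockSum ζ A j ω| ^ α) P :=
    fun j => (hcI j).add (hWI j).1
  have hqI : ∀ j, Integrable (fun ω => (blockSum ζ A j ω ^ 2 - 1) ^ 2) P := fun j => by
    refine (hbI j).mono' (((hWm j).pow_const 2).sub_const 1 |>.pow_const 2).aestronglyMeasurable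
      (ae_of_all _ fun ω => ?_)
    rw [Real.norm_of_nonneg (sq_nonneg _)]
    exact hpt _
  have hq : ∀ j, ∫ ω, (blockSum ζ A j ω ^ 2 - 1) ^ 2 ∂P ≤ M := fun j => by
    refine (integral_mono (hqI j) (hbI j) fun ω => hpt _).trans ?_
    rw [integral_add (hcI j) (hWI j).1,
      integral_sub (integrable_const 2) ((hW2 j).const_mul 2), integral_const_mul,
      integral_blockSum_sq h hα2 hA j]
    simp only [integral_const, probReal_univ, smul_eq_mul]
    linarith [(hWI j).2]
  have hψI : ∀ j, Integrable (fun ω => ψ (blockSum ζ A' j ω)) P := fun j => by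
    refine (integrable_const (1 : ℝ)).mono' (hψm.comp (hWm' j)).aestronglyMeasurable
      (ae_of_all _ fun ω => ?_)
    rw [Real.norm_of_nonneg (hψ0 _)]
    exact hψ1 _
  have hψE : ∀ j, ∫ ω, ψ (blockSum ζ A' j ω) ∂P ≤ M / a ^ α := fun j => by
    refine (integral_mono (hψI j) ((hWI' j).1.div_const _) fun ω => hψle _).trans ?_
    rw [integral_div]
    gcongr
    exact (hWI' j).2
  have hξsq : ∀ j ω, ξ j ω ^ 2 = (blockSum ζ A j ω ^ 2 - 1) ^ 2 * ψ (blockSum ζ A' j ω) :=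
    fun j ω => by rw [hξ]; simp only [mul_pow, hψsq]
  have hind := fun j => indepFun_blockSum h hAA j
  have hξL : ∀ j, MemLp (ξ j) 2 P := fun j => by
    refine (memLp_two_iff_integrable_sq (hξm j).aestronglyMeasurable).2 ?_
    refine (hqI j).mono' ((hξm j).pow_const 2).aestronglyMeasurable (ae_of_all _ fun ω => ?_)
    rw [Real.norm_of_nonneg (sq_nonneg _), hξsq]
    exact mul_le_of_le_one_right (sq_nonneg _) (hψ1 _)
  have hξ0 : ∀ j, ∫ ω, ξ j ω ∂P = 0 := fun j => by
    have := (hind j).integral_fun_comp_mul_comp (hWm j).aemeasurable (hWm' j).aemeasurable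
      (f := fun y => y ^ 2 - 1) (g := ψ) (by fun_prop) hψm.aestronglyMeasurable
    rw [hξ]
    simp only
    rw [this, integral_sub (hW2 j) (integrable_const 1), integral_blockSum_sq h hα2 hA j]
    simp
  have hξv : ∀ j, variance (ξ j) P ≤ M * (M / a ^ α) := fun j => by
    rw [variance_of_integral_eq_zero (hξm j).aemeasurable (hξ0 j)]
    simp only [hξsq]
    have := (hind j).integral_fun_comp_mul_comp (hWm j).aemeasurable (hWm' j).aemeasurable
      (f := fun y => (y ^ 2 - 1) ^ 2) (g := ψ) (by fun_prop) hψm.aestronglyMeasurable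
    rw [this]
    exact mul_le_mul (hq j) (hψE j) (integral_nonneg fun ω => hψ0 _)
      ((integral_nonneg fun ω => by positivity).trans (hq j))
  have hpair : Set.Pairwise (J : Set (Fin p)) fun i j => IndepFun (ξ i) (ξ j) P := by
    intro i _ j _ hij
    have hgm : ∀ i : Fin p, Measurable fun x : Fin m × Fin p → ℝ =>
        (((∑ k ∈ A, x (k, i)) / Real.sqrt A.card) ^ 2 - 1) *
          ψ ((∑ k ∈ A', x (k, i)) / Real.sqrt A'.card) := fun i =>
      (((measurable_blockFun A i).pow_const 2).sub_const 1).mul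
        (hψm.comp (measurable_blockFun A' i))
    have hgd : ∀ (i : Fin p) (x y : Fin m × Fin p → ℝ),
        (∀ q ∈ (Finset.univ : Finset (Fin m)) ×ˢ {i}, x q = y q) →
        (((∑ k ∈ A, x (k, i)) / Real.sqrt A.card) ^ 2 - 1) *
          ψ ((∑ k ∈ A', x (k, i)) / Real.sqrt A'.card) =
        (((∑ k ∈ A, y (k, i)) / Real.sqrt A.card) ^ 2 - 1) *
          ψ ((∑ k ∈ A', y (k, i)) / Real.sqrt A'.card) := by
      intro i x y hxy
      have : ∀ k, x (k, i) = y (k, i) := fun k => hxy (k, i) (by simp)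
      simp only [this]
    exact indepFun_of_disjoint_blocks h.measurable h.indep
      (Finset.disjoint_product.2 (Or.inr (by simpa using hij))) (hgm i) (hgm j) (hgd i) (hgd j)
  have hvar := IndepFun.variance_sum (μ := P) (fun j _ => hξL j) hpair
  have hmean : ∫ ω, (∑ j ∈ J, ξ j) ω ∂P = 0 := by
    simp only [Finset.sum_apply]
    rw [integral_finsetSum _ fun j _ => (hξL j).integrable (by norm_num)]
    exact Finset.sum_eq_zero fun j _ => hξ0 j
  have hcheb := meas_ge_le_variance_div_sq (memLp_finsetSum' J fun j _ => hξL j) hr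
  rw [hmean] at hcheb
  simp only [sub_zero, Finset.sum_apply] at hcheb
  refine hcheb.trans (ENNReal.ofReal_le_ofReal ?_)
  rw [hvar]
  gcongr
  calc ∑ j ∈ J, variance (ξ j) P ≤ ∑ _j ∈ J, M * (M / a ^ α) :=
        Finset.sum_le_sum fun j _ => hξv j
    _ = _ := by simp

end Threshold

section NoiseClass

variable {p n : ℕ} {α K : ℝ} {P : Measure (Fin n → Fin p → ℝ)}

lemma isNoiseArray_coord (hK : 0 < K) (hP : P ∈ Pclass p n α K) :
    IsNoiseArray P (fun (q : Fin n × Fin p) E => E q.1 q.2) α (K ^ α) := by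
  classical
  obtain ⟨ν, hν, hprob, hrect⟩ := hP
  have hνp : ∀ t j, IsProbabilityMeasure (ν t j) := fun t j => (hν t j).1
  have hm : ∀ q : Fin n × Fin p, Measurable fun E : Fin n → Fin p → ℝ => E q.1 q.2 :=
    fun q => by fun_prop
  have hrect' : ∀ (S : Finset (Fin n × Fin p)) (sets : Fin n × Fin p → Set ℝ),
      (∀ q ∈ S, MeasurableSet (sets q)) →
      P (⋂ q ∈ S, (fun E : Fin n → Fin p → ℝ => E q.1 q.2) ⁻¹' sets q) =
        ∏ q ∈ S, ν q.1 q.2 (sets q) := by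
    intro S sets hS
    have h := hrect (fun t j => if (t, j) ∈ S then sets (t, j) else Set.univ) (fun t j => by
      split_ifs with hq
      · exact hS _ hq
      · exact MeasurableSet.univ)
    have e1 : (⋂ q ∈ S, (fun E : Fin n → Fin p → ℝ => E q.1 q.2) ⁻¹' sets q) =
        {x | ∀ t j, x t j ∈ if (t, j) ∈ S then sets (t, j) else Set.univ} := by
      ext E
      simp only [Set.mem_iInter, Set.mem_preimage, Set.mem_ofPred_eq, Prod.forall]
      refine forall₂_congr fun t j => ?_
      by_cases hq : (t, j) ∈ S <;> simp [hq]
    rw [e1, h, ← Fintype.prod_prod_type' (f := fun t j =>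
      ν t j (if (t, j) ∈ S then sets (t, j) else Set.univ))]
    rw [← Finset.prod_subset (Finset.subset_univ S)]
    · exact Finset.prod_congr rfl fun q hq => by simp [hq]
    · intro q _ hq
      simp [hq]
  have hlaw : ∀ q : Fin n × Fin p, P.map (fun E => E q.1 q.2) = ν q.1 q.2 := by
    intro q
    ext s hs
    rw [Measure.map_apply (hm q) hs]
    simpa using hrect' {q} (fun _ => s) (fun _ _ => hs)
  have hint : ∀ t j, Integrable (fun x : ℝ => |x| ^ α) (ν t j) ∧
      ∫ x, |x| ^ α ∂ν t j ≤ K ^ α := by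
    intro t j
    have h5 := (hν t j).2.2.2.2
    have hI : Integrable (fun x : ℝ => |x / K| ^ α) (ν t j) := by
      refine ⟨Measurable.aestronglyMeasurable (by fun_prop), ?_⟩
      rw [hasFiniteIntegral_iff_ofReal (ae_of_all _ fun x => by positivity)]
      exact h5.trans_lt ENNReal.one_lt_top
    have hle : ∫ x : ℝ, |x / K| ^ α ∂ν t j ≤ 1 := by
      rw [integral_eq_lintegral_of_nonneg_ae (ae_of_all _ fun x => by positivity)
        hI.aestronglyMeasurable]
      exact ENNReal.toReal_le_of_le_ofReal zero_le_one (by simpa using h5)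
    have e : ∀ x : ℝ, |x| ^ α = K ^ α * |x / K| ^ α := fun x => by
      rw [abs_div, abs_of_pos hK, ← Real.mul_rpow hK.le (by positivity)]
      congr 1; field_simp
    rw [show (fun x : ℝ => |x| ^ α) = fun x => K ^ α * |x / K| ^ α from funext e]
    refine ⟨hI.const_mul _, ?_⟩
    rw [integral_const_mul]
    exact mul_le_of_le_one_right (by positivity) hle
  have hmapI : ∀ (q : Fin n × Fin p) (g : ℝ → ℝ), Measurable g →
      ∫ E, g (E q.1 q.2) ∂P = ∫ x, g x ∂ν q.1 q.2 := fun q g hg => by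
    rw [← hlaw q, integral_map (hm q).aemeasurable hg.aestronglyMeasurable]
  refine ⟨hm, ?_, fun q => ?_, fun q => ?_, fun q => ?_, fun q => ?_⟩
  · rw [iIndepFun_iff_measure_inter_preimage_eq_mul]
    intro S sets hS
    rw [hrect' S sets hS]
    refine Finset.prod_congr rfl fun q hq => ?_
    rw [← hlaw q, Measure.map_apply (hm q) (hS q hq)]
  · have := (hint q.1 q.2).1
    rw [← hlaw q] at this
    exact this.comp_measurable (hm q)
  · rw [hmapI q (fun x => x) measurable_id, (hν q.1 q.2).2.2.1]
  · rw [hmapI q (fun x => x ^ 2) (by fun_prop), integral_eq_lintegral_of_nonneg_ae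
      (ae_of_all _ fun x => sq_nonneg x) (Measurable.aestronglyMeasurable (by fun_prop)),
      (hν q.1 q.2).2.2.2.1]
    simp
  · rw [hmapI q (fun x => |x| ^ α) (by fun_prop)]
    exact (hint q.1 q.2).2

/-- The antisymmetrised noise entries `Z_k(j)`, `k < n / 2`. -/
noncomputable def foldedNoise (p n : ℕ) (q : Fin (n / 2) × Fin p) (E : Fin n → Fin p → ℝ) : ℝ :=
  Zb p n E q.1 q.2

lemma foldedNoise_eq (k : Fin (n / 2)) (j : Fin p) (E : Fin n → Fin p → ℝ) :
    foldedNoise p n (k, j) E =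
      (E ⟨k, by omega⟩ j - E ⟨n - 1 - k, by omega⟩ j) / Real.sqrt 2 := by
  simp only [foldedNoise, Zb, col]
  rw [dif_pos (show (k : ℕ) < n by omega), dif_pos (show n - 1 - (k : ℕ) < n by omega)]

lemma abs_sub_div_sqrt_two_rpow_le (hα : 1 ≤ α) (x y : ℝ) :
    |(x - y) / Real.sqrt 2| ^ α ≤ 2 ^ (α - 1) / Real.sqrt 2 ^ α * (|x| ^ α + |y| ^ α) := by
  rw [abs_div, Real.div_rpow (abs_nonneg _) (abs_nonneg _), abs_of_nonneg (Real.sqrt_nonneg _),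
    div_mul_eq_mul_div]
  gcongr
  calc |x - y| ^ α ≤ (|x| + |y|) ^ α :=
        Real.rpow_le_rpow (abs_nonneg _) (abs_sub x y) (by linarith)
    _ ≤ _ := by
      exact_mod_cast NNReal.rpow_add_le_mul_rpow_add_rpow (⟨|x|, abs_nonneg x⟩ : NNReal)
        ⟨|y|, abs_nonneg y⟩ hα

lemma isNoiseArray_foldedNoise (hα : 2 ≤ α) (hK : 0 < K) (hP : P ∈ Pclass p n α K) :
    IsNoiseArray P (foldedNoise p n) α ((Real.sqrt 2 * K) ^ α) := by
  classical
  have hc := isNoiseArray_coord hK hP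
  have : IsProbabilityMeasure P := by
    obtain ⟨ν, -, h, -⟩ := hP
    exact h
  have hα1 : 1 ≤ α := by linarith
  have hs2 : (0 : ℝ) < Real.sqrt 2 := by positivity
  let a : Fin (n / 2) × Fin p → Fin n × Fin p := fun q => (⟨q.1, by omega⟩, q.2)
  let b : Fin (n / 2) × Fin p → Fin n × Fin p := fun q => (⟨n - 1 - q.1, by omega⟩, q.2)
  have hab : ∀ q, a q ≠ b q := fun q h => by
    have := congrArg (fun r : Fin n × Fin p => (r.1 : ℕ)) h
    simp only [a, b] at this
    omega
  have hrep : ∀ q E, foldedNoise p n q E =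
      (E (a q).1 (a q).2 - E (b q).1 (b q).2) / Real.sqrt 2 := fun q E =>
    foldedNoise_eq q.1 q.2 E
  have hmeas : ∀ q, Measurable (foldedNoise p n q) := fun q => by
    have : foldedNoise p n q = fun E => (E (a q).1 (a q).2 - E (b q).1 (b q).2) / Real.sqrt 2 :=
      funext fun E => hrep q E
    rw [this]; fun_prop
  have hL2 := fun q => hc.memLp_two hα q
  have hI1 := fun q => (hL2 q).integrable (by norm_num)
  have hI2 := fun q => (hL2 q).integrable_sq
  have hIb : ∀ q, Integrable (fun E : Fin n → Fin p → ℝ => 2 ^ (α - 1) / Real.sqrt 2 ^ α *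
      (|E (a q).1 (a q).2| ^ α + |E (b q).1 (b q).2| ^ α)) P := fun q =>
    ((hc.integrable_rpow (a q)).add (hc.integrable_rpow (b q))).const_mul _
  have hIr : ∀ q, Integrable (fun E => |foldedNoise p n q E| ^ α) P := fun q => by
    refine (hIb q).mono' (((hmeas q).norm).pow_const α).aestronglyMeasurable
      (ae_of_all _ fun E => ?_)
    rw [Real.norm_of_nonneg (by positivity), hrep]
    exact abs_sub_div_sqrt_two_rpow_le hα1 _ _
  refine ⟨hmeas, ?_, hIr, fun q => ?_, fun q => ?_, fun q => ?_⟩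
  · have hblocks := iIndepFun_of_disjoint_blocks hc.measurable hc.indep
      (S := fun q => {a q, b q})
      (g := fun q x => (x (a q) - x (b q)) / Real.sqrt 2)
      (fun q r hqr => by
        rw [Finset.disjoint_left]
        intro x hx hy
        simp only [Finset.mem_insert, Finset.mem_singleton] at hx hy
        have hq := q.1.2
        have hr := r.1.2
        apply hqr
        rcases hx with rfl | rfl <;> rcases hy with hy | hy <;>
        · have h1 := congrArg (fun r : Fin n × Fin p => (r.1 : ℕ)) hy
          have h2 := congrArg (fun r : Fin n × Fin p => r.2) hy
          simp only [a, b] at h1 h2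
          exact Prod.ext (Fin.ext (by omega)) h2)
      (fun q => by fun_prop)
      (fun q x y hxy => by
        rw [hxy (a q) (by simp), hxy (b q) (by simp)])
    convert hblocks using 2 with q
    ext E
    exact hrep q E
  · simp only [hrep]
    rw [integral_div, integral_sub (hI1 (a q)) (hI1 (b q)), hc.integral_eq_zero,
      hc.integral_eq_zero]
    simp
  · have hprod : ∫ E : Fin n → Fin p → ℝ, E (a q).1 (a q).2 * E (b q).1 (b q).2 ∂P = 0 := by
      rw [(hc.indep.indepFun (hab q)).integral_fun_mul_eq_mul_integral
        (hc.measurable _).aestronglyMeasurable (hc.measurable _).aestronglyMeasurable,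
        hc.integral_eq_zero, zero_mul]
    have hprodI : Integrable (fun E : Fin n → Fin p → ℝ =>
        E (a q).1 (a q).2 * E (b q).1 (b q).2) P :=
      (hc.indep.indepFun (hab q)).integrable_mul (hI1 (a q)) (hI1 (b q))
    have hexp : ∀ E : Fin n → Fin p → ℝ, foldedNoise p n q E ^ 2 =
        (E (a q).1 (a q).2 ^ 2 + E (b q).1 (b q).2 ^ 2 -
          2 * (E (a q).1 (a q).2 * E (b q).1 (b q).2)) / 2 := fun E => by
      rw [hrep, div_pow, Real.sq_sqrt (by norm_num)]; ring
    have hIab : Integrable (fun E : Fin n → Fin p → ℝ =>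
        E (a q).1 (a q).2 ^ 2 + E (b q).1 (b q).2 ^ 2) P := (hI2 (a q)).add (hI2 (b q))
    simp only [hexp]
    rw [integral_div, integral_sub hIab (hprodI.const_mul 2), integral_add (hI2 (a q)) (hI2 (b q)),
      integral_const_mul, hprod, hc.integral_sq, hc.integral_sq]
    norm_num
  · refine (integral_mono (hIr q) (hIb q) fun E => ?_).trans ?_
    · simp only [hrep]
      exact abs_sub_div_sqrt_two_rpow_le hα1 _ _
    · rw [integral_const_mul, integral_add (hc.integrable_rpow (a q)) (hc.integrable_rpow (b q))]
      have h1 := hc.integral_rpow_le (a q)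
      have h2 := hc.integral_rpow_le (b q)
      have e : (Real.sqrt 2 * K) ^ α = 2 ^ (α - 1) / Real.sqrt 2 ^ α * (K ^ α + K ^ α) := by
        rw [Real.mul_rpow hs2.le hK.le]
        have e2 : Real.sqrt 2 ^ α * Real.sqrt 2 ^ α = 2 ^ (α - 1) * 2 := by
          rw [← Real.mul_rpow hs2.le hs2.le, Real.mul_self_sqrt (by norm_num),
            ← Real.rpow_add_one (by norm_num)]
          congr 1; ring
        have : Real.sqrt 2 ^ α ≠ 0 := by positivity
        field_simp
        linarith
      rw [e]
      gcongr

end NoiseClass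

section RobustMean

variable {p n : ℕ} {α K : ℝ} {P : Measure (Fin n → Fin p → ℝ)}

lemma Zb_add (X Y : Fin n → Fin p → ℝ) (k : ℕ) (j : Fin p) :
    Zb p n (X + Y) k j = Zb p n X k j + Zb p n Y k j := by
  have hc : ∀ i, col p n (X + Y) i j = col p n X i j + col p n Y i j := fun i => by
    unfold col
    split_ifs <;> simp
  simp only [Zb, hc]
  ring

lemma mul_le_of_sqrt_le_sqrt_mul {t q C L l : ℝ} (ht : 0 < t) (hq : 0 ≤ q) (hC : 0 ≤ C)
    (hL : 0 ≤ L) (hl : 0 ≤ l)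
    (h : Real.sqrt q ≤ Real.sqrt C * (Real.sqrt (L / t) + Real.sqrt (l / t))) :
    t * q ≤ 2 * C * (L + l) := by
  have h1 := pow_le_pow_left₀ (Real.sqrt_nonneg q) h 2
  rw [Real.sq_sqrt hq, mul_pow, Real.sq_sqrt hC] at h1
  have h2 := add_sq_le (a := Real.sqrt (L / t)) (b := Real.sqrt (l / t))
  rw [Real.sq_sqrt (by positivity), Real.sq_sqrt (by positivity)] at h2
  calc t * q ≤ t * (C * (2 * (L / t + l / t))) := by gcongr; exact h1.trans (by gcongr)
    _ = 2 * C * (L + l) := by field_simp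

/-- The high-probability error bound of a robust sparse mean estimator applied to the
antisymmetrised observations. -/
lemma measure_rsm_error_gt_le (hα : 2 ≤ α) (hK : 0 < K) (hP : P ∈ Pclass p n α K) {s : ℕ}
    {C₁ C₂ : ℝ} (hC₂ : 0 ≤ C₂) {est : (m : ℕ) → (Fin m → Fin p → ℝ) → ℝ → Fin p → ℝ}
    (hest : CondRSM p s α K C₁ C₂ est) {t : ℕ} (ht0 : 0 < t) (ht : t ≤ n / 2)
    {θ : Fin n → Fin p → ℝ} {μ : Fin p → ℝ} (hθ : ∀ k < t, ∀ j, Zb p n θ k j = μ j)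
    (hμ : l0 p μ ≤ s) {η : ℝ} (hη0 : 0 < η) (hη1 : η < 1)
    (hL : 0 ≤ (s : ℝ) * Real.log (Real.exp 1 * (p : ℝ) / (s : ℝ)))
    (hCt : C₁ * ((s : ℝ) * Real.log (Real.exp 1 * (p : ℝ) / (s : ℝ)) + Real.log (1 / η)) ≤ t) :
    P {E | 2 * C₂ * ((s : ℝ) * Real.log (Real.exp 1 * (p : ℝ) / (s : ℝ)) + Real.log (1 / η)) <
      t * sqnorm p fun j =>
        est t (fun (i : Fin t) (j : Fin p) => Zb p n (θ + E) i j) η j - μ j} ≤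
      ENNReal.ofReal η := by
  classical
  have hPp : IsProbabilityMeasure P := by
    obtain ⟨ν, -, h, -⟩ := hP
    exact h
  have hz := isNoiseArray_foldedNoise hα hK hP
  let c : Fin t → Fin (n / 2) := Fin.castLE ht
  let W : (Fin n → Fin p → ℝ) → Fin t → Fin p → ℝ := fun E i j => Zb p n (θ + E) i j
  have hW : ∀ i j E, W E i j = μ j + foldedNoise p n (c i, j) E := fun i j E => by
    simp only [W, Zb_add, foldedNoise, hθ i i.2, c, Fin.val_castLE]
  have hm := hz.measurable
  have hWi : ∀ i, Measurable fun E => W E i := fun i => by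
    simp only [measurable_pi_iff, hW]
    fun_prop
  have hWm : Measurable W := measurable_pi_lambda _ hWi
  have hind : iIndepFun (fun i E => W E i) P := by
    have := iIndepFun_of_disjoint_blocks hz.measurable hz.indep
      (S := fun i : Fin t => Finset.univ.image fun j : Fin p => (c i, j))
      (g := fun i x j => μ j + x (c i, j))
      (fun i k hik => by
        rw [Finset.disjoint_left]
        intro q hq hq'
        simp only [Finset.mem_image, Finset.mem_univ, true_and] at hq hq'
        obtain ⟨j, rfl⟩ := hq
        obtain ⟨j', hj⟩ := hq'
        exact hik (Fin.castLE_injective ht (Prod.mk.inj hj).1).symm)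
      (fun i => by fun_prop)
      (fun i x y hxy => by
        funext j
        rw [hxy (c i, j) (by simp)])
    convert this using 2 with i
    funext E j
    exact hW i j E
  have hL2 := fun q => hz.memLp_two hα q
  have hI1 := fun q => (hL2 q).integrable (by norm_num)
  have hmap : ∀ i (f : (Fin p → ℝ) → ℝ), Measurable f →
      (Integrable f (P.map fun E => W E i) ↔ Integrable (fun E => f (W E i)) P) ∧
      ∫ w, f w ∂(P.map fun E => W E i) = ∫ E, f (W E i) ∂P := fun i f hf =>
    ⟨integrable_map_measure hf.aestronglyMeasurable (hWi i).aemeasurable,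
      integral_map (hWi i).aemeasurable hf.aestronglyMeasurable⟩
  have key := hest.2 t μ (fun i => P.map fun E => W E i) (P.map W) η hη0 hη1 hμ
    (fun i => Measure.isProbabilityMeasure_map (hWi i).aemeasurable)
    (fun i j => by
      rw [(hmap i (fun w => w j) (by fun_prop)).1, (hmap i (fun w => w j) (by fun_prop)).2]
      simp only [hW]
      refine ⟨(integrable_const _).add (hI1 _), ?_⟩
      rw [integral_add (integrable_const _) (hI1 _), hz.integral_eq_zero]
      simp)
    (fun i j k => by
      rw [(hmap i (fun w => (w j - μ j) * (w k - μ k)) (by fun_prop)).1,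
        (hmap i (fun w => (w j - μ j) * (w k - μ k)) (by fun_prop)).2]
      simp only [hW, add_sub_cancel_left]
      refine ⟨(hL2 _).integrable_mul (hL2 _), ?_⟩
      split_ifs with hjk
      · subst hjk
        rw [← hz.integral_sq (c i, j)]
        exact integral_congr_ae (ae_of_all _ fun E => (sq _).symm)
      · rw [(hz.indep.indepFun (i := (c i, j)) (j := (c i, k))
          fun h => hjk (Prod.mk.inj h).2).integral_fun_mul_eq_mul_integral
          (hz.measurable _).aestronglyMeasurable (hz.measurable _).aestronglyMeasurable,
          hz.integral_eq_zero, zero_mul])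
    (fun i j => by
      rw [lintegral_map (by fun_prop) (hWi i)]
      simp only [hW, add_sub_cancel_left]
      rw [← ofReal_integral_eq_lintegral_ofReal (hz.integrable_rpow _)
        (ae_of_all _ fun E => by positivity)]
      exact ENNReal.ofReal_le_ofReal (hz.integral_rpow_le _))
    (Measure.isProbabilityMeasure_map hWm.aemeasurable)
    (fun S hS => by
      rw [Measure.map_apply hWm (by
        have : {W : Fin t → Fin p → ℝ | ∀ i, W i ∈ S i} = ⋂ i, (fun W => W i) ⁻¹' S i := by
          ext; simp
        rw [this]
        exact MeasurableSet.iInter fun i => measurable_pi_apply i (hS i))]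
      have h := hind.measure_inter_preimage_eq_mul Finset.univ (sets := S) (fun i _ => hS i)
      convert h using 2
      · ext E; simp
      · rename_i i _
        rw [Measure.map_apply (hWi i) (hS i)])
    hCt
  set G : Set (Fin t → Fin p → ℝ) := {W | Real.sqrt (sqnorm p fun j => est t W η j - μ j) ≤
        Real.sqrt C₂ * (Real.sqrt ((s : ℝ) * Real.log (Real.exp 1 * (p : ℝ) / (s : ℝ)) / (t : ℝ)) +
          Real.sqrt (Real.log (1 / η) / (t : ℝ)))} with hG
  have hestm : Measurable fun W : Fin t → Fin p → ℝ => est t W η :=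
    (hest.1 t).comp (measurable_id.prodMk measurable_const)
  have hGm : MeasurableSet G := by
    refine measurableSet_le ?_ measurable_const
    unfold sqnorm
    fun_prop
  rw [Measure.map_apply hWm hGm] at key
  have hsub : {E | 2 * C₂ * ((s : ℝ) * Real.log (Real.exp 1 * (p : ℝ) / (s : ℝ)) +
      Real.log (1 / η)) < t * sqnorm p fun j =>
        est t (fun (i : Fin t) (j : Fin p) => Zb p n (θ + E) i j) η j - μ j} ⊆ (W ⁻¹' G)ᶜ := by
    intro E hE hEG
    refine absurd (mul_le_of_sqrt_le_sqrt_mul (by exact_mod_cast ht0)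
      (Finset.sum_nonneg fun j _ => sq_nonneg _) hC₂ hL
      (Real.log_nonneg (by rw [one_div]; exact (one_le_inv₀ hη0).2 hη1.le)) hEG) (not_le.2 hE)
  refine (measure_mono hsub).trans ?_
  rw [prob_compl_eq_one_sub (hWm hGm), tsub_le_iff_right]
  calc (1 : ENNReal) = ENNReal.ofReal η + ENNReal.ofReal (1 - η) := by
        rw [← ENNReal.ofReal_add hη0.le (by linarith)]; simp
    _ ≤ _ := by gcongr

end RobustMean

section Parameters

variable {p s : ℕ} {α ε C₅ : ℝ}

lemma one_add_log_le_rpow (hα : 2 ≤ α) {x : ℝ} (hx : 0 < x) :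
    1 + Real.log x ≤ α / 2 * x ^ ((2 : ℝ) / α) := by
  have h := Real.log_le_sub_one_of_pos (Real.rpow_pos_of_pos hx ((2 : ℝ) / α))
  rw [Real.log_rpow hx] at h
  have h2 : α / 2 * (2 / α * Real.log x) = Real.log x := by field_simp
  nlinarith [mul_le_mul_of_nonneg_left h (by linarith : 0 ≤ α / 2)]

lemma sparse_log_eq (hs : 1 ≤ s) (hsp : s ≤ p) :
    (s : ℝ) * Real.log (Real.exp 1 * (p : ℝ) / (s : ℝ)) = s * (1 + Real.log ((p : ℝ) / s)) := by
  have hs0 : (0 : ℝ) < s := by exact_mod_cast hs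
  have hp0 : (0 : ℝ) < p := by exact_mod_cast hs.trans hsp
  rw [mul_div_assoc, Real.log_mul (Real.exp_ne_zero _) (by positivity), Real.log_exp]

lemma one_le_ratio (hs : 1 ≤ s) (hsp : s ≤ p) : (1 : ℝ) ≤ (p : ℝ) / s := by
  rw [one_le_div (by exact_mod_cast hs)]
  exact_mod_cast hsp

lemma sparse_le_sparse_log (hs : 1 ≤ s) (hsp : s ≤ p) :
    (s : ℝ) ≤ (s : ℝ) * Real.log (Real.exp 1 * (p : ℝ) / (s : ℝ)) := by
  rw [sparse_log_eq hs hsp]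
  exact le_mul_of_one_le_right (by positivity)
    (by linarith [Real.log_nonneg (one_le_ratio hs hsp)])

lemma sparse_le_rate (hs : 1 ≤ s) (hsp : s ≤ p) (hα : 2 ≤ α) :
    (s : ℝ) ≤ (s : ℝ) * ((p : ℝ) / s) ^ ((2 : ℝ) / α) :=
  le_mul_of_one_le_right (by positivity)
    (Real.one_le_rpow (one_le_ratio hs hsp) (by positivity))

lemma sparse_log_le_rate (hs : 1 ≤ s) (hsp : s ≤ p) (hα : 2 ≤ α) :
    (s : ℝ) * Real.log (Real.exp 1 * (p : ℝ) / (s : ℝ)) ≤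
      α / 2 * ((s : ℝ) * ((p : ℝ) / s) ^ ((2 : ℝ) / α)) := by
  rw [sparse_log_eq hs hsp, mul_left_comm]
  exact mul_le_mul_of_nonneg_left
    (one_add_log_le_rpow hα (by linarith [one_le_ratio hs hsp])) (by positivity)

lemma log_sixteen_div_pos (hε0 : 0 < ε) (hε1 : ε < 1) : 1 ≤ Real.log (16 / ε) := by
  rw [Real.le_log_iff_exp_le (by positivity)]
  have h := Real.exp_one_lt_d9
  have : 16 ≤ 16 / ε := by rw [le_div_iff₀ hε0]; linarith
  linarith

lemma le_rsmDelta1 (hs : 1 ≤ s) (hsp : s ≤ p) (hε0 : 0 < ε) (hε1 : ε < 1) (hC₅ : 0 ≤ C₅) :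
    C₅ * 2 ≤ rsmDelta1 p s ε C₅ := by
  have h1 := sparse_le_sparse_log hs hsp
  have h2 := log_sixteen_div_pos hε0 hε1
  have h3 : (1 : ℝ) ≤ s := by exact_mod_cast hs
  exact mul_le_mul_of_nonneg_left (by linarith) hC₅

lemma one_le_log_rsmDelta1 (hs : 1 ≤ s) (hsp : s ≤ p) (hε0 : 0 < ε) (hε1 : ε < 1)
    (hC₅ : 16 ≤ C₅) : 1 ≤ Real.log (rsmDelta1 p s ε C₅) := by
  have h := le_rsmDelta1 hs hsp hε0 hε1 (by linarith : 0 ≤ C₅)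
  rw [Real.le_log_iff_exp_le (by linarith)]
  linarith [Real.exp_one_lt_d9]

lemma log_rsmDelta1_le (hs : 1 ≤ s) (hsp : s ≤ p) (hα : 2 ≤ α) (hε0 : 0 < ε) (hε1 : ε < 1)
    (hC₅ : 0 ≤ C₅) :
    Real.log (rsmDelta1 p s ε C₅) ≤
      2 * Real.sqrt C₅ * ((α / 2 + Real.log (16 / ε)) *
        ((s : ℝ) * ((p : ℝ) / s) ^ ((2 : ℝ) / α))) := by
  have h1 := sparse_log_le_rate hs hsp hα
  have h2 := log_sixteen_div_pos hε0 hε1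
  have h3 : (1 : ℝ) ≤ s := by exact_mod_cast hs
  have h4 := sparse_le_rate hs hsp hα
  have h5 := sparse_le_sparse_log hs hsp
  set Q := (s : ℝ) * ((p : ℝ) / s) ^ ((2 : ℝ) / α)
  set L := (s : ℝ) * Real.log (Real.exp 1 * (p : ℝ) / (s : ℝ))
  set l := Real.log (16 / ε)
  have hH : 1 ≤ L + l := by linarith
  have hΔ0 : 0 ≤ rsmDelta1 p s ε C₅ := by
    linarith [le_rsmDelta1 hs hsp hε0 hε1 hC₅]
  have hlog : Real.log (rsmDelta1 p s ε C₅) ≤ 2 * Real.sqrt (rsmDelta1 p s ε C₅) := by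
    have := Real.log_le_self (Real.sqrt_nonneg (rsmDelta1 p s ε C₅))
    rw [Real.log_sqrt hΔ0] at this
    linarith
  refine hlog.trans ?_
  rw [mul_assoc]
  refine mul_le_mul_of_nonneg_left ?_ (by norm_num)
  rw [show rsmDelta1 p s ε C₅ = C₅ * (L + l) from rfl, Real.sqrt_mul hC₅]
  refine mul_le_mul_of_nonneg_left ?_ (Real.sqrt_nonneg _)
  calc Real.sqrt (L + l) ≤ L + l := by
        rw [Real.sqrt_le_left (by linarith)]
        nlinarith
    _ ≤ (α / 2 + l) * Q := by nlinarith

lemma rpow_le_rsmA : ((p : ℝ) / s) ^ ((1 : ℝ) / α) ≤ rsmA p s α ε 1 C₅ := by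
  unfold rsmA
  rw [one_mul]
  exact le_add_of_nonneg_right (by positivity)

lemma one_le_rsmA (hs : 1 ≤ s) (hsp : s ≤ p) (hα : 2 ≤ α) : 1 ≤ rsmA p s α ε 1 C₅ :=
  (Real.one_le_rpow (one_le_ratio hs hsp) (by positivity)).trans rpow_le_rsmA

lemma sparse_mul_rsmA_sq_le (hs : 1 ≤ s)
    (hΔ : 0 ≤ Real.log (rsmDelta1 p s ε C₅)) :
    (s : ℝ) * rsmA p s α ε 1 C₅ ^ 2 ≤
      2 * ((s : ℝ) * ((p : ℝ) / s) ^ ((2 : ℝ) / α)) + 2 * Real.log (rsmDelta1 p s ε C₅) := by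
  have hs0 : (0 : ℝ) < s := by exact_mod_cast hs
  have hx : 0 ≤ (p : ℝ) / s := by positivity
  unfold rsmA
  rw [one_mul]
  set y := Real.log (rsmDelta1 p s ε C₅)
  have h1 : (((p : ℝ) / s) ^ ((1 : ℝ) / α)) ^ 2 = ((p : ℝ) / s) ^ ((2 : ℝ) / α) := by
    rw [← Real.rpow_natCast, ← Real.rpow_mul hx]
    congr 1; push_cast; ring
  have h2 : (s : ℝ) * ((s : ℝ) ^ (-(1 : ℝ) / 2) * Real.sqrt (Real.log y)) ^ 2 ≤ y := by
    have e : ((s : ℝ) ^ (-(1 : ℝ) / 2)) ^ 2 = (s : ℝ)⁻¹ := by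
      rw [← Real.rpow_natCast, ← Real.rpow_mul hs0.le, ← Real.rpow_neg_one]
      congr 1; norm_num
    rw [mul_pow, e, ← mul_assoc, mul_inv_cancel₀ hs0.ne', one_mul]
    rcases le_total 0 (Real.log y) with h | h
    · rw [Real.sq_sqrt h]
      exact Real.log_le_self hΔ
    · rw [Real.sqrt_eq_zero_of_nonpos h]
      simpa using hΔ
  have h3 := add_sq_le (a := ((p : ℝ) / s) ^ ((1 : ℝ) / α))
    (b := (s : ℝ) ^ (-(1 : ℝ) / 2) * Real.sqrt (Real.log y))
  rw [h1] at h3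
  nlinarith [mul_le_mul_of_nonneg_left h3 hs0.le]

lemma dim_mul_rsmA_rpow_le (hs : 1 ≤ s) (hsp : s ≤ p) (hα : 2 ≤ α) :
    (p : ℝ) * rsmA p s α ε 1 C₅ ^ (2 - α) ≤ (s : ℝ) * ((p : ℝ) / s) ^ ((2 : ℝ) / α) := by
  have hs0 : (0 : ℝ) < s := by exact_mod_cast hs
  have hp0 : (0 : ℝ) < p := by exact_mod_cast hs.trans hsp
  have hx : 0 < (p : ℝ) / s := by positivity
  calc (p : ℝ) * rsmA p s α ε 1 C₅ ^ (2 - α)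
      ≤ p * (((p : ℝ) / s) ^ ((1 : ℝ) / α)) ^ (2 - α) := by
        refine mul_le_mul_of_nonneg_left ?_ hp0.le
        exact Real.rpow_le_rpow_of_nonpos (by positivity) rpow_le_rsmA (by linarith)
    _ = p * (((p : ℝ) / s) ^ ((2 : ℝ) / α) / ((p : ℝ) / s)) := by
        rw [← Real.rpow_mul hx.le, ← Real.rpow_sub_one hx.ne']
        congr 2
        field_simp
    _ = _ := by field_simp

lemma dim_div_rsmA_rpow_le (hs : 1 ≤ s) (hsp : s ≤ p) (hα : 2 ≤ α) :
    (p : ℝ) / rsmA p s α ε 1 C₅ ^ α ≤ s := by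
  have hs0 : (0 : ℝ) < s := by exact_mod_cast hs
  have hp0 : (0 : ℝ) < p := by exact_mod_cast hs.trans hsp
  have hx : 0 < (p : ℝ) / s := by positivity
  have h : (p : ℝ) / s ≤ rsmA p s α ε 1 C₅ ^ α := by
    calc (p : ℝ) / s = (((p : ℝ) / s) ^ ((1 : ℝ) / α)) ^ α := by
          rw [← Real.rpow_mul hx.le, one_div_mul_cancel (by linarith), Real.rpow_one]
      _ ≤ _ := Real.rpow_le_rpow (by positivity) rpow_le_rsmA (by linarith)
  rw [div_le_iff₀ (hx.trans_le h), mul_comm]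
  rwa [div_le_iff₀ hs0] at h

/-- The confidence parameter `η_t` passed to the robust sparse mean estimator. -/
noncomputable def rsmEta (p s n : ℕ) (ε C₅ t : ℝ) : ℝ :=
  Real.exp ((s : ℝ) * Real.log (Real.exp 1 * (p : ℝ) / (s : ℝ)) -
    min t (rsmDelta2 p s n ε C₅) / C₅)

lemma one_le_log_two_mul {n : ℕ} (hn : 2 ≤ n) : 1 ≤ Real.log (2 * (n : ℝ)) := by
  have hn' : (2 : ℝ) ≤ n := by exact_mod_cast hn
  rw [Real.le_log_iff_exp_le (by positivity)]
  linarith [Real.exp_one_lt_d9]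

lemma rsmDelta1_le_rsmDelta2 {n : ℕ} (hn : 2 ≤ n) (hε0 : 0 < ε) (hC₅ : 0 ≤ C₅) :
    rsmDelta1 p s ε C₅ ≤ rsmDelta2 p s n ε C₅ := by
  have h := one_le_log_two_mul hn
  unfold rsmDelta1 rsmDelta2
  gcongr
  linarith

lemma log_one_div_rsmEta {n : ℕ} {t : ℝ} :
    (s : ℝ) * Real.log (Real.exp 1 * (p : ℝ) / (s : ℝ)) + Real.log (1 / rsmEta p s n ε C₅ t) =
      min t (rsmDelta2 p s n ε C₅) / C₅ := by
  rw [one_div, Real.log_inv, rsmEta, Real.log_exp]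
  ring

lemma rsmEta_le {n : ℕ} {t : ℝ} (hn : 2 ≤ n) (hε0 : 0 < ε) (hC₅ : 0 < C₅)
    (ht : rsmDelta1 p s ε C₅ < t) : rsmEta p s n ε C₅ t ≤ ε / 16 := by
  have h1 : rsmDelta1 p s ε C₅ ≤ min t (rsmDelta2 p s n ε C₅) :=
    le_min ht.le (rsmDelta1_le_rsmDelta2 hn hε0 hC₅.le)
  have h2 := div_le_div_of_nonneg_right h1 hC₅.le
  rw [rsmDelta1, mul_div_cancel_left₀ _ hC₅.ne'] at h2
  calc rsmEta p s n ε C₅ t ≤ Real.exp (-Real.log (16 / ε)) :=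
        Real.exp_le_exp.2 (by linarith)
    _ = ε / 16 := by rw [Real.exp_neg, Real.exp_log (by positivity), inv_div]

lemma rsmEta_le_add {n : ℕ} {t : ℝ} (hn : 2 ≤ n) (hε0 : 0 < ε) (hC₅ : 0 < C₅) :
    rsmEta p s n ε C₅ t ≤
      Real.exp ((s : ℝ) * Real.log (Real.exp 1 * (p : ℝ) / (s : ℝ))) * Real.exp (-(t / C₅)) +
        ε / (16 * Real.log (2 * (n : ℝ))) := by
  have h := one_le_log_two_mul hn
  rcases le_total t (rsmDelta2 p s n ε C₅) with ht | ht
  · rw [rsmEta, min_eq_left ht, sub_eq_add_neg, Real.exp_add]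
    exact le_add_of_nonneg_right (by positivity)
  · rw [rsmEta, min_eq_right ht, rsmDelta2, mul_div_cancel_left₀ _ hC₅.ne', sub_add_cancel_left,
      Real.exp_neg, Real.exp_log (by positivity), inv_div]
    exact le_add_of_nonneg_left (by positivity)

lemma sum_exp_dyadic_le {C Δ : ℝ} (hC : 0 < C) (hΔ : C ≤ Δ) (N : ℕ) :
    ∑ k ∈ Finset.range N, (if Δ < (2 : ℝ) ^ k then Real.exp (-((2 : ℝ) ^ k / C)) else 0) ≤
      2 * Real.exp (-(Δ / C)) := by
  have key : ∑ k ∈ Finset.range N,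
      (if Δ < (2 : ℝ) ^ k then Real.exp (-((2 : ℝ) ^ k / C)) else 0) ≤
      2 * Real.exp (-(Δ / C)) - 2 * Real.exp (-(max Δ ((2 : ℝ) ^ N) / C)) := by
    induction N with
    | zero =>
      simp only [Finset.range_zero, Finset.sum_empty, sub_nonneg]
      gcongr
      exact le_max_left _ _
    | succ N ih =>
      rw [Finset.sum_range_succ]
      split_ifs with h
      · rw [max_eq_right h.le] at ih
        rw [max_eq_right (h.le.trans (by rw [pow_succ]; linarith [pow_pos (two_pos (α := ℝ)) N]))]
        have hu : 1 ≤ (2 : ℝ) ^ N / C := by rw [one_le_div hC]; linarith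
        set u := (2 : ℝ) ^ N / C
        have e : -((2 : ℝ) ^ (N + 1) / C) = -u + -u := by simp only [u]; ring
        have h2 : Real.exp (-u) ≤ 1 / 2 := by
          rw [Real.exp_neg, inv_le_comm₀ (Real.exp_pos _) (by norm_num)]
          linarith [Real.add_one_le_exp u]
        rw [e, Real.exp_add]
        nlinarith [Real.exp_pos (-u)]
      · rw [max_eq_left (not_lt.1 h)] at ih
        have : Real.exp (-(max Δ ((2 : ℝ) ^ (N + 1)) / C)) ≤ Real.exp (-(Δ / C)) := by
          gcongr
          exact le_max_left _ _
        linarith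
  linarith [Real.exp_pos (-(max Δ ((2 : ℝ) ^ N) / C))]

lemma card_dyadic_le {Δ : ℝ} (N : ℕ) (hΔ : 1 ≤ Δ) :
    (((Finset.range N).filter fun k => k ≠ 0 ∧ (2 : ℝ) ^ k ≤ Δ).card : ℝ) ≤
      2 * Real.log Δ := by
  have hsub : ((Finset.range N).filter fun k => k ≠ 0 ∧ (2 : ℝ) ^ k ≤ Δ) ⊆
      Finset.Ioc 0 ⌊2 * Real.log Δ⌋₊ := by
    intro k hk
    simp only [Finset.mem_filter, Finset.mem_range] at hk
    refine Finset.mem_Ioc.2 ⟨Nat.pos_of_ne_zero hk.2.1, Nat.le_floor ?_⟩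
    have h := Real.log_le_log (by positivity) hk.2.2
    rw [Real.log_pow] at h
    nlinarith [Real.log_two_gt_d9, Nat.cast_nonneg (α := ℝ) k]
  have hc := Finset.card_le_card hsub
  rw [Nat.card_Ioc, Nat.sub_zero] at hc
  exact (Nat.cast_le.2 hc).trans (Nat.floor_le (by positivity [Real.log_nonneg hΔ]))

lemma log_half_add_one_le {n : ℕ} (hn : 2 ≤ n) :
    ((Nat.log 2 (n / 2) + 1 : ℕ) : ℝ) ≤ 2 * Real.log (2 * (n : ℝ)) := by
  have h1 : 2 ^ (Nat.log 2 (n / 2) + 1) ≤ 2 * n := by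
    have := Nat.pow_log_le_self 2 (x := n / 2) (by omega)
    rw [pow_succ]
    omega
  have h2 : (2 : ℝ) ^ (Nat.log 2 (n / 2) + 1) ≤ 2 * n := by exact_mod_cast h1
  have h := Real.log_le_log (by positivity) h2
  rw [Real.log_pow] at h
  nlinarith [Real.log_two_gt_d9, Nat.cast_nonneg (α := ℝ) (Nat.log 2 (n / 2) + 1)]

end Parameters

section Statistics

variable {p n : ℕ}

/-- The indices of parity `r` among the first `t` antisymmetrised observations. -/
def parityBlock (n r t : ℕ) : Finset (Fin (n / 2)) :=
  Finset.univ.filter fun k => (k : ℕ) < t ∧ (k : ℕ) % 2 = r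

lemma sum_parityBlock {r t : ℕ} (hr : r < 2) (ht : t ≤ n / 2) (hte : Even t) (f : ℕ → ℝ) :
    ∑ k ∈ parityBlock n r t, f k = ∑ i ∈ Finset.range (t / 2), f (2 * i + r) := by
  have ht2 : 2 * (t / 2) = t := Nat.two_mul_div_two_of_even hte
  refine Finset.sum_bij' (fun k _ => (k : ℕ) / 2)
    (fun i hi => ⟨2 * i + r, by have := Finset.mem_range.1 hi; omega⟩) ?_ ?_ ?_ ?_ ?_
  · intro k hk
    simp only [parityBlock, Finset.mem_filter, Finset.mem_univ, true_and] at hk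
    rw [Finset.mem_range]; omega
  · intro i hi
    have := Finset.mem_range.1 hi
    simp only [parityBlock, Finset.mem_filter, Finset.mem_univ, true_and]
    omega
  · intro k hk
    simp only [parityBlock, Finset.mem_filter, Finset.mem_univ, true_and] at hk
    exact Fin.ext (by simp only; omega)
  · intro i hi
    simp only; omega
  · intro k hk
    simp only [parityBlock, Finset.mem_filter, Finset.mem_univ, true_and] at hk
    congr 1; omega

lemma card_parityBlock {r t : ℕ} (hr : r < 2) (ht : t ≤ n / 2) (hte : Even t) :
    ((parityBlock n r t).card : ℝ) = t / 2 := by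
  have h := sum_parityBlock hr ht hte fun _ => (1 : ℝ)
  obtain ⟨m, rfl⟩ := hte.two_dvd
  simp only [Finset.sum_const, nsmul_eq_mul, mul_one, Finset.card_range] at h
  rw [h, Nat.mul_div_cancel_left _ two_pos]
  push_cast; ring

lemma parityBlock_nonempty {r t : ℕ} (hr : r < 2) (ht : t ≤ n / 2) (hte : Even t)
    (ht0 : 0 < t) : (parityBlock n r t).Nonempty := by
  rw [← Finset.card_pos, ← Nat.cast_pos (α := ℝ), card_parityBlock hr ht hte]
  positivity

lemma disjoint_parityBlock (t : ℕ) : Disjoint (parityBlock n 0 t) (parityBlock n 1 t) := by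
  rw [Finset.disjoint_left]
  intro k hk hk'
  simp only [parityBlock, Finset.mem_filter] at hk hk'
  omega

lemma sum_sqrt_two_mul_Zb_div {r t : ℕ} (hr : r < 2) (ht : t ≤ n / 2) (hte : Even t) (ht0 : 0 < t)
    {θ : Fin n → Fin p → ℝ} {v : Fin p → ℝ} (hθ : ∀ k < t, ∀ j, Zb p n θ k j = v j)
    (E : Fin n → Fin p → ℝ) (j : Fin p) :
    (∑ i ∈ Finset.range (t / 2), Real.sqrt 2 * Zb p n (θ + E) (2 * i + r) j) / Real.sqrt t =
      Real.sqrt (t / 2) * v j + blockSum (foldedNoise p n) (parityBlock n r t) j E := by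
  have ht' : (0 : ℝ) < t := by exact_mod_cast ht0
  have hst : Real.sqrt t = Real.sqrt 2 * Real.sqrt (t / 2) := by
    rw [← Real.sqrt_mul (by norm_num)]; congr 1; ring
  have hq : Real.sqrt ((t : ℝ) / 2) ≠ 0 := by positivity
  have hsq : Real.sqrt ((t : ℝ) / 2) * Real.sqrt (t / 2) = t / 2 :=
    Real.mul_self_sqrt (by positivity)
  rw [← Finset.mul_sum, hst, mul_div_mul_left _ _ (by positivity),
    ← sum_parityBlock hr ht hte fun k => Zb p n (θ + E) k j]
  have e : ∑ k ∈ parityBlock n r t, Zb p n (θ + E) k j =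
      t / 2 * v j + ∑ k ∈ parityBlock n r t, foldedNoise p n (k, j) E := by
    rw [← card_parityBlock hr ht hte, ← nsmul_eq_mul, ← Finset.sum_const, ← Finset.sum_add_distrib]
    refine Finset.sum_congr rfl fun k hk => ?_
    simp only [parityBlock, Finset.mem_filter] at hk
    rw [Zb_add, hθ k hk.2.1, foldedNoise]
  rw [e, blockSum, card_parityBlock hr ht hte, add_div]
  congr 1
  rw [div_eq_iff hq]
  linear_combination (-v j) * hsq

lemma Ata_eq_of_even {t : ℕ} (ht : t ≤ n / 2) (hte : Even t) (ht0 : 0 < t)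
    {θ : Fin n → Fin p → ℝ} {v : Fin p → ℝ} (hθ : ∀ k < t, ∀ j, Zb p n θ k j = v j)
    (E : Fin n → Fin p → ℝ) (a : ℝ) :
    Ata p n (θ + E) t a =
      ∑ j, ((Real.sqrt (t / 2) * v j +
          blockSum (foldedNoise p n) (parityBlock n 0 t) j E) ^ 2 - 1) *
        (if a ≤ |Real.sqrt (t / 2) * v j +
          blockSum (foldedNoise p n) (parityBlock n 1 t) j E| then 1 else 0) := by
  have hs : Real.sqrt 2 ≠ 0 := by positivity
  have h1 : ∀ j, Yt1 p n (θ + E) t j = Real.sqrt (t / 2) * v j +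
      blockSum (foldedNoise p n) (parityBlock n 0 t) j E := fun j => by
    rw [← sum_sqrt_two_mul_Zb_div (by norm_num) ht hte ht0 hθ, Yt1]
    congr 1
    refine Finset.sum_congr rfl fun i _ => ?_
    rw [Zb, mul_div_cancel₀ _ hs]; rfl
  have h2 : ∀ j, Yt2 p n (θ + E) t j = Real.sqrt (t / 2) * v j +
      blockSum (foldedNoise p n) (parityBlock n 1 t) j E := fun j => by
    rw [← sum_sqrt_two_mul_Zb_div (by norm_num) ht hte ht0 hθ, Yt2]
    congr 1
    refine Finset.sum_congr rfl fun i _ => ?_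
    rw [Zb, mul_div_cancel₀ _ hs, show n - 1 - (2 * i + 1) = n - 2 - 2 * i by omega]
  rw [Ata, if_neg (by rintro rfl; simp at hte)]
  simp only [h1, h2]

lemma Ata_one_eq (hn : 2 ≤ n) {θ : Fin n → Fin p → ℝ} {v : Fin p → ℝ}
    (hθ : ∀ j, Zb p n θ 0 j = v j) (E : Fin n → Fin p → ℝ) (a : ℝ) :
    Ata p n (θ + E) 1 a =
      ∑ j, ((v j + blockSum (foldedNoise p n) {⟨0, by omega⟩} j E) ^ 2 - 1) *
        (if a ≤ |v j + blockSum (foldedNoise p n) {⟨0, by omega⟩} j E| then 1 else 0) := by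
  have h : ∀ j, Y1 p n (θ + E) j =
      v j + blockSum (foldedNoise p n) {⟨0, by omega⟩} j E := fun j => by
    have e : Y1 p n (θ + E) j = Zb p n (θ + E) 0 j := rfl
    simp [e, Zb_add, hθ, blockSum, foldedNoise]
  rw [Ata, if_pos rfl]
  simp only [h]

lemma half_sq_sub_sq_le (v w : ℝ) : v ^ 2 / 2 - w ^ 2 ≤ (v + w) ^ 2 := by
  nlinarith [sq_nonneg (v + 2 * w)]

lemma selfThreshold_ge {a : ℝ} (ha : 1 ≤ a) {v : Fin p → ℝ} {S : Finset (Fin p)}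
    (hv : ∀ j ∉ S, v j = 0) (w : Fin p → ℝ) :
    sqnorm p v / 2 - ∑ j ∈ S, w j ^ 2 - S.card * a ^ 2 ≤
      ∑ j, ((v j + w j) ^ 2 - 1) * (if a ≤ |v j + w j| then (1 : ℝ) else 0) := by
  have hge : ∀ y : ℝ, a ≤ |y| → a ^ 2 ≤ y ^ 2 := fun y hy => by
    rw [← sq_abs y]; gcongr
  have e : sqnorm p v = ∑ j ∈ S, v j ^ 2 := by
    refine (Finset.sum_subset (Finset.subset_univ S) fun j _ hj => ?_).symm
    rw [hv j hj]; ring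
  calc sqnorm p v / 2 - ∑ j ∈ S, w j ^ 2 - S.card * a ^ 2
      = ∑ j ∈ S, (v j ^ 2 / 2 - w j ^ 2 - a ^ 2) := by
        rw [e, Finset.sum_sub_distrib, Finset.sum_sub_distrib, Finset.sum_div, Finset.sum_const,
          nsmul_eq_mul]
    _ ≤ ∑ j ∈ S, ((v j + w j) ^ 2 - 1) * (if a ≤ |v j + w j| then (1 : ℝ) else 0) := by
        refine Finset.sum_le_sum fun j _ => ?_
        have h := half_sq_sub_sq_le (v j) (w j)
        split_ifs with hj
        · nlinarith
        · rw [not_le] at hj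
          have : (v j + w j) ^ 2 ≤ a ^ 2 := by
            rw [← sq_abs]; gcongr
          linarith
    _ ≤ _ := by
        refine Finset.sum_le_sum_of_subset_of_nonneg (Finset.subset_univ S) fun j _ _ => ?_
        split_ifs with hj
        · nlinarith [hge _ hj]
        · simp

lemma crossThreshold_ge {a : ℝ} {v : Fin p → ℝ} {S : Finset (Fin p)}
    (hv : ∀ j ∉ S, v j = 0) (w w' : Fin p → ℝ) :
    sqnorm p v / 2 - ∑ j ∈ S, w j ^ 2 - ∑ j ∈ S, w' j ^ 2 - S.card * (a ^ 2 + 1) -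
        |∑ j ∈ Sᶜ, (w j ^ 2 - 1) * (if a ≤ |w' j| then (1 : ℝ) else 0)| ≤
      ∑ j, ((v j + w j) ^ 2 - 1) * (if a ≤ |v j + w' j| then (1 : ℝ) else 0) := by
  have e : sqnorm p v = ∑ j ∈ S, v j ^ 2 := by
    refine (Finset.sum_subset (Finset.subset_univ S) fun j _ hj => ?_).symm
    rw [hv j hj]; ring
  have h1 : sqnorm p v / 2 - ∑ j ∈ S, w j ^ 2 - ∑ j ∈ S, w' j ^ 2 - S.card * (a ^ 2 + 1) ≤
      ∑ j ∈ S, ((v j + w j) ^ 2 - 1) * (if a ≤ |v j + w' j| then (1 : ℝ) else 0) := by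
    calc _ = ∑ j ∈ S, (v j ^ 2 / 2 - w j ^ 2 - w' j ^ 2 - (a ^ 2 + 1)) := by
          rw [e, Finset.sum_sub_distrib, Finset.sum_sub_distrib, Finset.sum_sub_distrib,
            Finset.sum_div, Finset.sum_const, nsmul_eq_mul]
      _ ≤ _ := by
          refine Finset.sum_le_sum fun j _ => ?_
          split_ifs with hj
          · nlinarith [half_sq_sub_sq_le (v j) (w j), sq_nonneg a, sq_nonneg (w' j)]
          · rw [not_le] at hj
            have : (v j + w' j) ^ 2 ≤ a ^ 2 := by
              rw [← sq_abs]; gcongr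
            nlinarith [half_sq_sub_sq_le (v j) (w' j), sq_nonneg (w j)]
  have h2 : ∑ j ∈ Sᶜ, ((v j + w j) ^ 2 - 1) * (if a ≤ |v j + w' j| then (1 : ℝ) else 0) =
      ∑ j ∈ Sᶜ, (w j ^ 2 - 1) * (if a ≤ |w' j| then (1 : ℝ) else 0) := by
    refine Finset.sum_congr rfl fun j hj => ?_
    rw [hv j (Finset.mem_compl.1 hj), zero_add, zero_add]
  rw [← Finset.sum_add_sum_compl S, h2]
  linarith [neg_abs_le (∑ j ∈ Sᶜ, (w j ^ 2 - 1) * (if a ≤ |w' j| then (1 : ℝ) else 0))]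

lemma Zb_eq_zero_of_mem_Theta0 {θ : Fin n → Fin p → ℝ} (hθ : θ ∈ Theta0 p n) {k : ℕ}
    (hk : k < n / 2) (j : Fin p) : Zb p n θ k j = 0 := by
  obtain ⟨μ, hμ⟩ := hθ
  rw [Zb, col, col, dif_pos (show k < n by omega), dif_pos (show n - 1 - k < n by omega), hμ, hμ]
  simp

/-- The location of the dyadic grid point associated with a change point. -/
lemma exists_dyadic_scale (hn : 2 ≤ n) {t0 : ℕ} (h1 : 1 ≤ t0) (h2 : t0 ≤ n - 1) :
    ∃ t ∈ Tgrid n, t ≤ n / 2 ∧ t ≤ t0 ∧ t ≤ n - t0 ∧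
      (t0 : ℝ) * ((n : ℝ) - t0) / n ≤ 2 * t := by
  set m := min t0 (n - t0) with hm
  have hm0 : m ≠ 0 := by omega
  have hmn : m ≤ n / 2 := by omega
  refine ⟨2 ^ Nat.log 2 m, Finset.mem_image.2 ⟨Nat.log 2 m, Finset.mem_range.2
    (Nat.lt_succ_of_le (Nat.log_mono_right hmn)), rfl⟩, ?_, ?_, ?_, ?_⟩
  · exact (Nat.pow_log_le_self 2 hm0).trans hmn
  · exact (Nat.pow_log_le_self 2 hm0).trans (min_le_left _ _)
  · exact (Nat.pow_log_le_self 2 hm0).trans (min_le_right _ _)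
  · have hlt := Nat.lt_pow_succ_log_self (b := 2) (by norm_num) m
    have hlt' : (m : ℝ) ≤ 2 * ((2 ^ Nat.log 2 m : ℕ) : ℝ) := by
      rw [pow_succ, mul_comm] at hlt
      exact_mod_cast hlt.le
    refine le_trans ?_ hlt'
    have hn0 : (0 : ℝ) < n := by positivity
    have ht0 : (t0 : ℝ) ≤ n := by exact_mod_cast (by omega : t0 ≤ n)
    rw [hm, Nat.cast_min, Nat.cast_sub (by omega), div_le_iff₀ hn0]
    rcases le_total (t0 : ℝ) (n - t0) with h | h
    · rw [min_eq_left h]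
      nlinarith [Nat.cast_nonneg (α := ℝ) t0]
    · rw [min_eq_right h]
      nlinarith

lemma exists_shift_of_mem_ThetaAt {t0 s : ℕ} {ρ : ℝ} (hn : 2 ≤ n) (h1 : 1 ≤ t0)
    (h2 : t0 ≤ n - 1) {θ : Fin n → Fin p → ℝ} (hθ : θ ∈ ThetaAt p n t0 s ρ) :
    ∃ t ∈ Tgrid n, 0 < t ∧ t ≤ n / 2 ∧ ∃ v : Fin p → ℝ, (∀ k < t, ∀ j, Zb p n θ k j = v j) ∧
      l0 p v ≤ s ∧ ρ ^ 2 ≤ 4 * (t * sqnorm p v) := by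
  obtain ⟨μ₁, μ₂, hμ₁, hμ₂, hl, hρ⟩ := hθ
  obtain ⟨t, htT, htn, ht1, ht2, ht⟩ := exists_dyadic_scale hn h1 h2
  have ht0 : 0 < t := by
    obtain ⟨k, -, rfl⟩ := Finset.mem_image.1 htT
    positivity
  refine ⟨t, htT, ht0, htn, fun j => (μ₁ j - μ₂ j) / Real.sqrt 2, fun k hk j => ?_, ?_, ?_⟩
  · rw [Zb, col, col, dif_pos (show k < n by omega), dif_pos (show n - 1 - k < n by omega),
      hμ₁ _ (by simp only; omega), hμ₂ _ (by simp only; omega)]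
  · refine le_trans (Finset.card_le_card ?_) hl
    intro j
    simp
  · have hq : 0 ≤ sqnorm p fun j => μ₁ j - μ₂ j := Finset.sum_nonneg fun j _ => sq_nonneg _
    have e : sqnorm p (fun j => (μ₁ j - μ₂ j) / Real.sqrt 2) =
        sqnorm p (fun j => μ₁ j - μ₂ j) / 2 := by
      simp only [sqnorm, div_pow, Real.sq_sqrt (zero_le_two (α := ℝ)), Finset.sum_div]
    rw [e]
    refine hρ.trans ((mul_le_mul_of_nonneg_right ht hq).trans (le_of_eq (by ring)))

end Statistics

/-- The bound on the `α`-th moment of normalised sums of antisymmetrised noise entries. -/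
noncomputable def foldedMoment (α K : ℝ) : ℝ := momentBound α ((Real.sqrt 2 * K) ^ α)

lemma foldedMoment_nonneg {α K : ℝ} (hK : 0 < K) : 0 ≤ foldedMoment α K := by
  unfold foldedMoment momentBound
  positivity

/-- Constraints on the tuning constants `C₄`, `C₅` of the test. -/
structure IsTuned (α K ε C₁ C₂ C₄ C₅ : ℝ) : Prop where
  four_le : 4 ≤ α
  K_pos : 0 < K
  ε_pos : 0 < ε
  ε_lt_one : ε < 1
  C₁_nonneg : 0 ≤ C₁
  C₂_pos : 0 < C₂
  le_C₄ : 16 * (2 * foldedMoment α K ^ 2 + foldedMoment α K + 1) / ε ≤ C₄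
  C₁_le : C₁ ≤ C₅
  sixteen_le : 16 ≤ C₅
  signal_lt : 3 + 32 / ε + 2 * C₄ + (2 + C₄) * (2 * Real.sqrt C₅ * (α / 2 + Real.log (16 / ε))) <
    C₅ / 16
  rsm_lt : 32 * C₂ * (α / 2 + Real.log (16 / ε)) < C₅

lemma exists_isTuned {α K ε C₁ C₂ : ℝ} (hα : 4 ≤ α) (hK : 0 < K) (hε0 : 0 < ε) (hε1 : ε < 1)
    (hC₁ : 0 ≤ C₁) (hC₂ : 0 < C₂) : ∃ C₄ C₅, IsTuned α K ε C₁ C₂ C₄ C₅ := by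
  have hM := foldedMoment_nonneg (α := α) hK
  have hl := log_sixteen_div_pos hε0 hε1
  set C₄ := 16 * (2 * foldedMoment α K ^ 2 + foldedMoment α K + 1) / ε with hC₄
  set H := α / 2 + Real.log (16 / ε) with hH
  have hC₄0 : 0 ≤ C₄ := by positivity
  have hH0 : 0 ≤ H := by linarith
  set b := 3 + 32 / ε + 2 * C₄
  have hb : 0 ≤ b := by positivity
  set c := 16 * (b + (2 + C₄) * (2 * H)) + 16 + C₁ + 32 * C₂ * H with hc
  have hc16 : 16 ≤ c := by
    have : 0 ≤ 16 * (b + (2 + C₄) * (2 * H)) := by positivity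
    have : 0 ≤ 32 * C₂ * H := by positivity
    linarith
  have hcc : c ≤ c ^ 2 := by nlinarith
  have h1 : 0 ≤ (2 + C₄) * (2 * H) := by positivity
  have h2 : 0 ≤ 32 * C₂ * H := by positivity
  refine ⟨C₄, c ^ 2, hα, hK, hε0, hε1, hC₁, hC₂, le_rfl, by linarith, by linarith, ?_, ?_⟩
  · rw [Real.sqrt_sq (by linarith)]
    change b + (2 + C₄) * (2 * c * H) < c ^ 2 / 16
    have hle : 16 * (b + (2 + C₄) * (2 * H)) + 16 ≤ c := by linarith
    nlinarith [mul_le_mul_of_nonneg_left hle (by linarith : 0 ≤ c)]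
  · change 32 * C₂ * H < c ^ 2
    linarith

namespace IsTuned

variable {α K ε C₁ C₂ C₄ C₅ : ℝ}

lemma two_le (h : IsTuned α K ε C₁ C₂ C₄ C₅) : 2 ≤ α := by linarith [h.four_le]

lemma C₅_pos (h : IsTuned α K ε C₁ C₂ C₄ C₅) : 0 < C₅ := by linarith [h.sixteen_le]

lemma mul_C₄_ge (h : IsTuned α K ε C₁ C₂ C₄ C₅) :
    16 * (2 * foldedMoment α K ^ 2 + foldedMoment α K + 1) ≤ ε * C₄ := by
  have := h.le_C₄
  rwa [div_le_iff₀ h.ε_pos, mul_comm C₄] at this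

lemma one_le_C₄ (h : IsTuned α K ε C₁ C₂ C₄ C₅) : 1 ≤ C₄ := by
  have h1 := h.mul_C₄_ge
  have h2 := foldedMoment_nonneg (α := α) h.K_pos
  have := h.ε_pos
  have := h.ε_lt_one
  by_contra! hlt
  nlinarith [sq_nonneg (foldedMoment α K)]

lemma moment_div_le (h : IsTuned α K ε C₁ C₂ C₄ C₅) : foldedMoment α K / C₄ ≤ ε / 16 := by
  rw [div_le_iff₀ (by linarith [h.one_le_C₄])]
  nlinarith [h.mul_C₄_ge, sq_nonneg (foldedMoment α K)]

lemma two_mul_moment_sq_div_le (h : IsTuned α K ε C₁ C₂ C₄ C₅) :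
    2 * (foldedMoment α K ^ 2 / C₄ ^ 2) ≤ ε / 16 := by
  have h4 := h.one_le_C₄
  have hM := foldedMoment_nonneg (α := α) h.K_pos
  rw [← mul_div_assoc, div_le_iff₀ (by positivity)]
  nlinarith [h.mul_C₄_ge, mul_nonneg h.ε_pos.le (mul_nonneg (by linarith : 0 ≤ C₄)
    (sub_nonneg.2 h4))]

end IsTuned

section Detection

variable {p n s : ℕ} {α K ε C₁ C₂ C₄ C₅ : ℝ} {P : Measure (Fin n → Fin p → ℝ)}
  {θ : Fin n → Fin p → ℝ}

lemma isProbabilityMeasure_of_mem_Pclass (hP : P ∈ Pclass p n α K) : IsProbabilityMeasure P := by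
  obtain ⟨ν, -, h, -⟩ := hP
  exact h

lemma measure_Ata_one_null_le (h : IsTuned α K ε C₁ C₂ C₄ C₅) (hs : 1 ≤ s) (hsp : s ≤ p)
    (hn : 2 ≤ n) (hP : P ∈ Pclass p n α K) (hθ : ∀ j, Zb p n θ 0 j = 0) :
    P {E | C₄ * ((s : ℝ) * ((p : ℝ) / s) ^ ((2 : ℝ) / α)) <
      Ata p n (θ + E) 1 (rsmA p s α ε 1 C₅)} ≤ ENNReal.ofReal (foldedMoment α K / C₄) := by
  have := isProbabilityMeasure_of_mem_Pclass hP
  have hα := h.two_le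
  have hz := isNoiseArray_foldedNoise hα h.K_pos hP
  have hs0 : (0 : ℝ) < s := by exact_mod_cast hs
  have hp0 : (0 : ℝ) < p := by exact_mod_cast hs.trans hsp
  have hC₄ := h.one_le_C₄
  have ha := one_le_rsmA (ε := ε) (C₅ := C₅) hs hsp hα
  have hM := foldedMoment_nonneg (α := α) h.K_pos
  have hQ : 0 < (s : ℝ) * ((p : ℝ) / s) ^ ((2 : ℝ) / α) := by positivity
  have key := measure_selfThreshold_ge_le hz hα (A := {⟨0, by omega⟩})
    (Finset.singleton_nonempty _) (a := rsmA p s α ε 1 C₅)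
    (r := C₄ * ((s : ℝ) * ((p : ℝ) / s) ^ ((2 : ℝ) / α))) (by linarith) (by positivity)
  refine (measure_mono fun E hE => ?_).trans (key.trans (ENNReal.ofReal_le_ofReal ?_))
  · rw [Set.mem_ofPred_eq, Ata_one_eq hn hθ] at hE
    rw [Set.mem_ofPred_eq]
    simpa only [zero_add] using hE.le
  · change (p : ℝ) * (foldedMoment α K * _) / _ ≤ _
    rw [div_le_div_iff₀ (by positivity) (by positivity)]
    nlinarith [mul_le_mul_of_nonneg_left (dim_mul_rsmA_rpow_le (ε := ε) (C₅ := C₅) hs hsp hα)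
      (by positivity : 0 ≤ foldedMoment α K * C₄)]

lemma measure_crossNoise_ge_le (h : IsTuned α K ε C₁ C₂ C₄ C₅) (hs : 1 ≤ s) (hsp : s ≤ p)
    (hP : P ∈ Pclass p n α K) {t : ℕ} (ht : t ≤ n / 2) (hte : Even t) (ht0 : 0 < t)
    (J : Finset (Fin p)) {y : ℝ} (hy : 1 ≤ y) :
    P {E | C₄ * Real.sqrt (s * y) ≤
      |∑ j ∈ J, (blockSum (foldedNoise p n) (parityBlock n 0 t) j E ^ 2 - 1) *
        (if rsmA p s α ε 1 C₅ ≤ |blockSum (foldedNoise p n) (parityBlock n 1 t) j E|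
          then 1 else 0)|} ≤
      ENNReal.ofReal (foldedMoment α K ^ 2 / C₄ ^ 2 / y) := by
  have := isProbabilityMeasure_of_mem_Pclass hP
  have hα := h.two_le
  have hz := isNoiseArray_foldedNoise hα h.K_pos hP
  have hs0 : (0 : ℝ) < s := by exact_mod_cast hs
  have hC₄ := h.one_le_C₄
  have ha := one_le_rsmA (ε := ε) (C₅ := C₅) hs hsp hα
  have ha' : 0 < rsmA p s α ε 1 C₅ ^ α := by positivity
  have hM := foldedMoment_nonneg (α := α) h.K_pos
  have key := measure_crossThreshold_ge_le hz h.four_le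
    (parityBlock_nonempty (r := 0) (by norm_num) ht hte ht0)
    (parityBlock_nonempty (r := 1) (by norm_num) ht hte ht0) (disjoint_parityBlock t) J
    (a := rsmA p s α ε 1 C₅) (r := C₄ * Real.sqrt (s * y)) (by linarith) (by positivity)
  refine key.trans (ENNReal.ofReal_le_ofReal ?_)
  change (J.card : ℝ) * (foldedMoment α K * (foldedMoment α K / _)) / _ ≤ _
  have hJ : (J.card : ℝ) ≤ p := by
    exact_mod_cast (Finset.card_le_univ J).trans_eq (Fintype.card_fin p)
  have hJs : (J.card : ℝ) / rsmA p s α ε 1 C₅ ^ α ≤ s :=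
    (div_le_div_of_nonneg_right hJ ha'.le).trans (dim_div_rsmA_rpow_le hs hsp hα)
  rw [mul_pow, Real.sq_sqrt (by positivity)]
  calc (J.card : ℝ) * (foldedMoment α K * (foldedMoment α K / rsmA p s α ε 1 C₅ ^ α)) /
        (C₄ ^ 2 * (s * y))
      = (J.card : ℝ) / rsmA p s α ε 1 C₅ ^ α * foldedMoment α K ^ 2 / (C₄ ^ 2 * (s * y)) := by
        ring
    _ ≤ s * foldedMoment α K ^ 2 / (C₄ ^ 2 * (s * y)) := by gcongr
    _ = _ := by field_simp

lemma measure_Ata_null_le (h : IsTuned α K ε C₁ C₂ C₄ C₅) (hs : 1 ≤ s) (hsp : s ≤ p)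
    (hP : P ∈ Pclass p n α K) {t : ℕ} (ht : t ≤ n / 2) (hte : Even t) (ht0 : 0 < t)
    (hθ : ∀ k < t, ∀ j, Zb p n θ k j = 0) :
    P {E | C₄ * Real.sqrt (s * Real.log (rsmDelta1 p s ε C₅)) <
      Ata p n (θ + E) t (rsmA p s α ε 1 C₅)} ≤
      ENNReal.ofReal (foldedMoment α K ^ 2 / C₄ ^ 2 / Real.log (rsmDelta1 p s ε C₅)) := by
  refine (measure_mono fun E hE => ?_).trans (measure_crossNoise_ge_le h hs hsp hP ht hte ht0
    Finset.univ (one_le_log_rsmDelta1 hs hsp h.ε_pos h.ε_lt_one h.sixteen_le))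
  rw [Set.mem_ofPred_eq, Ata_eq_of_even ht hte ht0 (v := 0) hθ] at hE
  simp only [Pi.zero_apply, mul_zero, zero_add] at hE
  exact hE.le.trans (le_abs_self _)

lemma measure_rsm_error_le (h : IsTuned α K ε C₁ C₂ C₄ C₅) (hs : 1 ≤ s) (hsp : s ≤ p)
    (hn : 2 ≤ n) (hP : P ∈ Pclass p n α K)
    {est : (m : ℕ) → (Fin m → Fin p → ℝ) → ℝ → Fin p → ℝ}
    (hest : CondRSM p s α K C₁ C₂ est) {t : ℕ} (ht : t ≤ n / 2) (ht0 : 0 < t)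
    (htΔ : rsmDelta1 p s ε C₅ < t) {v : Fin p → ℝ} (hθ : ∀ k < t, ∀ j, Zb p n θ k j = v j)
    (hv : l0 p v ≤ s) :
    P {E | 2 * C₂ / C₅ * min (t : ℝ) (rsmDelta2 p s n ε C₅) < t * sqnorm p fun j =>
        est t (fun (i : Fin t) (j : Fin p) => Zb p n (θ + E) i j) (rsmEta p s n ε C₅ t) j - v j} ≤
      ENNReal.ofReal (rsmEta p s n ε C₅ t) := by
  have hC₅ := h.C₅_pos
  have hη := rsmEta_le hn h.ε_pos hC₅ htΔ
  have key := measure_rsm_error_gt_le h.two_le h.K_pos hP h.C₂_pos.le hest ht0 ht hθ hv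
    (η := rsmEta p s n ε C₅ t) (Real.exp_pos _) (by linarith [h.ε_lt_one])
    (by linarith [sparse_le_sparse_log hs hsp, Nat.cast_nonneg (α := ℝ) s]) (by
      rw [log_one_div_rsmEta]
      have hΔ2 := (rsmDelta1_le_rsmDelta2 (p := p) (s := s) hn h.ε_pos hC₅.le)
      have hΔ1 := le_rsmDelta1 hs hsp h.ε_pos h.ε_lt_one hC₅.le
      have h0 : 0 ≤ min (t : ℝ) (rsmDelta2 p s n ε C₅) :=
        le_min (by positivity) (by linarith)
      calc C₁ * (min (t : ℝ) (rsmDelta2 p s n ε C₅) / C₅)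
          ≤ C₅ * (min (t : ℝ) (rsmDelta2 p s n ε C₅) / C₅) := by
            gcongr; exact h.C₁_le
        _ ≤ t := by rw [mul_div_cancel₀ _ hC₅.ne']; exact min_le_left _ _)
  rw [log_one_div_rsmEta] at key
  convert key using 5
  ring

lemma sparse_support_card {v : Fin p → ℝ} (hv : l0 p v ≤ s) :
    ((Finset.univ.filter fun j => v j ≠ 0).card : ℝ) ≤ s := by
  exact_mod_cast hv

lemma LL_nonneg (hn : 2 ≤ n) : 0 ≤ LL n := by
  have hn' : (2 : ℝ) ≤ n := by exact_mod_cast hn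
  refine Real.log_nonneg ?_
  rw [Real.le_log_iff_exp_le (by positivity)]
  linarith [Real.exp_one_lt_d9]

lemma measure_sum_sq_ge_le (h : IsTuned α K ε C₁ C₂ C₄ C₅) (hs : 1 ≤ s)
    (hP : P ∈ Pclass p n α K) {A : Finset (Fin (n / 2))} (hA : A.Nonempty) {J : Finset (Fin p)}
    (hJ : (J.card : ℝ) ≤ s) :
    P {E | 16 * s / ε ≤ ∑ j ∈ J, blockSum (foldedNoise p n) A j E ^ 2} ≤
      ENNReal.ofReal (ε / 16) := by
  have := isProbabilityMeasure_of_mem_Pclass hP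
  have hs0 : (0 : ℝ) < s := by exact_mod_cast hs
  have hε := h.ε_pos
  refine (measure_sum_blockSum_sq_ge_le (isNoiseArray_foldedNoise h.two_le h.K_pos hP) h.two_le hA J
    (r := 16 * s / ε) (by positivity)).trans (ENNReal.ofReal_le_ofReal ?_)
  rw [div_div_eq_mul_div, div_le_div_iff₀ (by positivity) (by norm_num)]
  nlinarith

/-- Under the signal strength condition the squared shift dominates all noise contributions to
the thresholded statistic. -/
lemma noise_lt_signal (h : IsTuned α K ε C₁ C₂ C₄ C₅) (hs : 1 ≤ s) (hsp : s ≤ p) (hn : 2 ≤ n)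
    {ρ : ℝ} (hρ : C₅ * ((s : ℝ) * ((p : ℝ) / (s : ℝ)) ^ ((2 : ℝ) / α) + LL n) ≤ ρ ^ 2) :
    s * (rsmA p s α ε 1 C₅ ^ 2 + 1) + 2 * (16 * s / ε) +
      2 * C₄ * ((s : ℝ) * ((p : ℝ) / (s : ℝ)) ^ ((2 : ℝ) / α)) +
      C₄ * Real.log (rsmDelta1 p s ε C₅) < ρ ^ 2 / 16 := by
  have hε := h.ε_pos
  have hC₅ := h.C₅_pos
  have hy := one_le_log_rsmDelta1 (p := p) hs hsp h.ε_pos h.ε_lt_one h.sixteen_le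
  have hyQ := log_rsmDelta1_le hs hsp h.two_le h.ε_pos h.ε_lt_one hC₅.le
  have hsA := sparse_mul_rsmA_sq_le (p := p) (α := α) (ε := ε) (C₅ := C₅) hs (by linarith)
  have hsQ := sparse_le_rate hs hsp h.two_le
  have hs1 : (1 : ℝ) ≤ s := by exact_mod_cast hs
  have hLL := LL_nonneg hn
  have hC₄ := h.one_le_C₄
  have hsig := h.signal_lt
  set Q := (s : ℝ) * ((p : ℝ) / s) ^ ((2 : ℝ) / α)
  set y := Real.log (rsmDelta1 p s ε C₅)
  set H := α / 2 + Real.log (16 / ε)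
  have h1 : 2 * (16 * s / ε) ≤ 32 / ε * Q := by
    rw [show 2 * (16 * (s : ℝ) / ε) = 32 / ε * s by ring]
    gcongr
  have h2 : (2 + C₄) * y ≤ (2 + C₄) * (2 * Real.sqrt C₅ * (H * Q)) := by gcongr
  have h3 := mul_lt_mul_of_pos_right hsig (by linarith : 0 < Q)
  nlinarith

lemma sqrt_mul_le_add {x y : ℝ} (hx : 0 ≤ x) (hy : 0 ≤ y) : Real.sqrt (x * y) ≤ x + y := by
  rw [Real.sqrt_le_left (by positivity)]
  nlinarith [mul_nonneg hx hy]

lemma measure_Ata_one_alt_le (h : IsTuned α K ε C₁ C₂ C₄ C₅) (hs : 1 ≤ s) (hsp : s ≤ p)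
    (hn : 2 ≤ n) (hP : P ∈ Pclass p n α K) {ρ : ℝ}
    (hρ : C₅ * ((s : ℝ) * ((p : ℝ) / (s : ℝ)) ^ ((2 : ℝ) / α) + LL n) ≤ ρ ^ 2)
    {v : Fin p → ℝ} (hθ : ∀ j, Zb p n θ 0 j = v j) (hv : l0 p v ≤ s)
    (hvρ : ρ ^ 2 ≤ 4 * sqnorm p v) :
    P {E | Ata p n (θ + E) 1 (rsmA p s α ε 1 C₅) ≤
      C₄ * ((s : ℝ) * ((p : ℝ) / s) ^ ((2 : ℝ) / α))} ≤ ENNReal.ofReal (ε / 16) := by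
  set S : Finset (Fin p) := Finset.univ.filter fun j => v j ≠ 0 with hS
  have hSc : (S.card : ℝ) ≤ s := sparse_support_card hv
  refine (measure_mono fun E hE => ?_).trans (measure_sum_sq_ge_le h hs hP
    (A := {⟨0, by omega⟩}) (Finset.singleton_nonempty _) hSc)
  rw [Set.mem_ofPred_eq, Ata_one_eq hn hθ] at hE
  rw [Set.mem_ofPred_eq]
  by_contra! hlt
  have hsig := noise_lt_signal h hs hsp hn hρ
  have hge := selfThreshold_ge (one_le_rsmA (ε := ε) (C₅ := C₅) hs hsp h.two_le) (v := v) (S := S)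
    (fun j hj => by simpa [hS] using hj)
    (fun j => blockSum (foldedNoise p n) {⟨0, by omega⟩} j E)
  have hy := one_le_log_rsmDelta1 (p := p) hs hsp h.ε_pos h.ε_lt_one h.sixteen_le
  have hC₄ := h.one_le_C₄
  have hs0 : (1 : ℝ) ≤ s := by exact_mod_cast hs
  have hsQ := sparse_le_rate hs hsp h.two_le
  have h1 := mul_le_mul_of_nonneg_right hSc (sq_nonneg (rsmA p s α ε 1 C₅))
  have h2 : 0 ≤ C₄ * Real.log (rsmDelta1 p s ε C₅) := by positivity
  have h3 : 0 ≤ 16 * s / ε := by have := h.ε_pos; positivity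
  have h4 : 0 ≤ C₄ * ((s : ℝ) * ((p : ℝ) / s) ^ ((2 : ℝ) / α)) := by positivity
  linarith [sq_nonneg ρ]

lemma measure_Ata_alt_le (h : IsTuned α K ε C₁ C₂ C₄ C₅) (hs : 1 ≤ s) (hsp : s ≤ p)
    (hn : 2 ≤ n) (hP : P ∈ Pclass p n α K) {ρ : ℝ}
    (hρ : C₅ * ((s : ℝ) * ((p : ℝ) / (s : ℝ)) ^ ((2 : ℝ) / α) + LL n) ≤ ρ ^ 2)
    {t : ℕ} (ht : t ≤ n / 2) (hte : Even t) (ht0 : 0 < t)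
    {v : Fin p → ℝ} (hθ : ∀ k < t, ∀ j, Zb p n θ k j = v j) (hv : l0 p v ≤ s)
    (hvρ : ρ ^ 2 ≤ 4 * (t * sqnorm p v)) :
    P {E | Ata p n (θ + E) t (rsmA p s α ε 1 C₅) ≤
      C₄ * Real.sqrt (s * Real.log (rsmDelta1 p s ε C₅))} ≤ ENNReal.ofReal (3 * (ε / 16)) := by
  set S : Finset (Fin p) := Finset.univ.filter fun j => v j ≠ 0 with hS
  have hSc : (S.card : ℝ) ≤ s := sparse_support_card hv
  have hε := h.ε_pos
  have hA : ∀ r < 2, (parityBlock n r t).Nonempty := fun r hr =>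
    parityBlock_nonempty hr ht hte ht0
  have e : 3 * (ε / 16) = ε / 16 + ε / 16 + ε / 16 := by ring
  rw [e, ENNReal.ofReal_add (by positivity) (by positivity),
    ENNReal.ofReal_add (by positivity) (by positivity)]
  have hcross : foldedMoment α K ^ 2 / C₄ ^ 2 / 1 ≤ ε / 16 := by
    have := h.two_mul_moment_sq_div_le
    have : 0 ≤ foldedMoment α K ^ 2 / C₄ ^ 2 := by positivity
    rw [div_one]; linarith
  refine (measure_mono fun E hE => ?_).trans ((measure_union_le _ _).trans
    (add_le_add ((measure_union_le _ _).trans (add_le_add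
      (measure_sum_sq_ge_le h hs hP (hA 0 (by norm_num)) hSc)
      (measure_sum_sq_ge_le h hs hP (hA 1 (by norm_num)) hSc)))
      ((measure_crossNoise_ge_le h hs hsp hP ht hte ht0 Sᶜ le_rfl).trans
        (ENNReal.ofReal_le_ofReal hcross))))
  rw [Set.mem_ofPred_eq, Ata_eq_of_even ht hte ht0 hθ] at hE
  simp only [Set.mem_union, Set.mem_ofPred_eq]
  by_contra! hlt
  obtain ⟨⟨h0, h1⟩, h2⟩ := hlt
  have hsig := noise_lt_signal h hs hsp hn hρ
  have hge := crossThreshold_ge (a := rsmA p s α ε 1 C₅) (v := fun j => Real.sqrt (t / 2) * v j)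
    (S := S) (fun j hj => by
      have : v j = 0 := by simpa [hS] using hj
      rw [this, mul_zero])
    (fun j => blockSum (foldedNoise p n) (parityBlock n 0 t) j E)
    (fun j => blockSum (foldedNoise p n) (parityBlock n 1 t) j E)
  have hsq : sqnorm p (fun j => Real.sqrt (t / 2) * v j) = t / 2 * sqnorm p v := by
    simp only [sqnorm, mul_pow, Finset.mul_sum]
    rw [Real.sq_sqrt (by positivity)]
  rw [hsq] at hge
  have hy := one_le_log_rsmDelta1 (p := p) hs hsp h.ε_pos h.ε_lt_one h.sixteen_le
  have hC₄ := h.one_le_C₄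
  have hs0 : (1 : ℝ) ≤ s := by exact_mod_cast hs
  have hsQ := sparse_le_rate hs hsp h.two_le
  have g1 := mul_le_mul_of_nonneg_right hSc
    (by positivity : 0 ≤ rsmA p s α ε 1 C₅ ^ 2 + 1)
  have g2 : C₄ * Real.sqrt (s * 1) ≤ C₄ * s := by
    gcongr
    rw [mul_one, Real.sqrt_le_left (by positivity)]
    nlinarith
  have g3 : C₄ * Real.sqrt (s * Real.log (rsmDelta1 p s ε C₅)) ≤
      C₄ * (s + Real.log (rsmDelta1 p s ε C₅)) := by
    gcongr
    exact sqrt_mul_le_add (by positivity) (by linarith)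
  have g4 := mul_le_mul_of_nonneg_left hsQ (by linarith : 0 ≤ C₄)
  linarith

lemma sqnorm_le_two_mul_add (x v : Fin p → ℝ) :
    sqnorm p v ≤ 2 * sqnorm p x + 2 * sqnorm p (fun j => x j - v j) := by
  simp only [sqnorm, Finset.mul_sum, ← Finset.sum_add_distrib]
  refine Finset.sum_le_sum fun j _ => ?_
  nlinarith [sq_nonneg (2 * x j - v j)]

lemma rsm_threshold_lt (h : IsTuned α K ε C₁ C₂ C₄ C₅) (hs : 1 ≤ s) (hsp : s ≤ p) (hn : 2 ≤ n)
    {ρ : ℝ} (hρ : C₅ * ((s : ℝ) * ((p : ℝ) / (s : ℝ)) ^ ((2 : ℝ) / α) + LL n) ≤ ρ ^ 2) (t : ℝ) :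
    16 * (2 * C₂ / C₅ * min t (rsmDelta2 p s n ε C₅)) < ρ ^ 2 := by
  have hε := h.ε_pos
  have hC₅ := h.C₅_pos
  have hC₂ := h.C₂_pos
  have hl := log_sixteen_div_pos h.ε_pos h.ε_lt_one
  have hα := h.two_le
  have hs1 : (1 : ℝ) ≤ s := by exact_mod_cast hs
  have hsQ := sparse_le_rate hs hsp h.two_le
  have hLQ := sparse_log_le_rate hs hsp h.two_le
  have hLL := LL_nonneg hn
  have hlog := one_le_log_two_mul hn
  have hn0 : (0 : ℝ) < n := by positivity
  have hll : Real.log (Real.log (2 * (n : ℝ))) ≤ LL n := by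
    unfold LL
    gcongr
    norm_num
  have hsplit : Real.log (16 * Real.log (2 * (n : ℝ)) / ε) =
      Real.log (16 / ε) + Real.log (Real.log (2 * (n : ℝ))) := by
    rw [← Real.log_mul (by positivity) (by positivity)]
    congr 1; ring
  have hsig := h.rsm_lt
  have hmin : 2 * C₂ / C₅ * min t (rsmDelta2 p s n ε C₅) ≤
      2 * C₂ * ((s : ℝ) * Real.log (Real.exp 1 * (p : ℝ) / (s : ℝ)) +
        Real.log (16 * Real.log (2 * (n : ℝ)) / ε)) :=
    (mul_le_mul_of_nonneg_left (min_le_right _ _) (by positivity)).trans_eq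
      (by rw [rsmDelta2, ← mul_assoc, div_mul_cancel₀ _ hC₅.ne'])
  rw [hsplit] at hmin
  set Q := (s : ℝ) * ((p : ℝ) / s) ^ ((2 : ℝ) / α)
  set L := (s : ℝ) * Real.log (Real.exp 1 * (p : ℝ) / (s : ℝ))
  set l := Real.log (16 / ε)
  have hsum : L + (l + Real.log (Real.log (2 * (n : ℝ)))) ≤ (α / 2 + l) * (Q + LL n) := by
    nlinarith
  have h2 := mul_le_mul_of_nonneg_left hsum (by positivity : 0 ≤ 2 * C₂)
  have h3 := mul_lt_mul_of_pos_right hsig (by linarith : 0 < Q + LL n)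
  nlinarith

lemma measure_rsm_alt_le (h : IsTuned α K ε C₁ C₂ C₄ C₅) (hs : 1 ≤ s) (hsp : s ≤ p)
    (hn : 2 ≤ n) (hP : P ∈ Pclass p n α K)
    {est : (m : ℕ) → (Fin m → Fin p → ℝ) → ℝ → Fin p → ℝ}
    (hest : CondRSM p s α K C₁ C₂ est) {ρ : ℝ}
    (hρ : C₅ * ((s : ℝ) * ((p : ℝ) / (s : ℝ)) ^ ((2 : ℝ) / α) + LL n) ≤ ρ ^ 2)
    {t : ℕ} (ht : t ≤ n / 2) (ht0 : 0 < t)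
    (htΔ : rsmDelta1 p s ε C₅ < t) {v : Fin p → ℝ} (hθ : ∀ k < t, ∀ j, Zb p n θ k j = v j)
    (hv : l0 p v ≤ s) (hvρ : ρ ^ 2 ≤ 4 * (t * sqnorm p v)) :
    P {E | t * sqnorm p
        (est t (fun (i : Fin t) (j : Fin p) => Zb p n (θ + E) i j) (rsmEta p s n ε C₅ t)) ≤
        2 * C₂ / C₅ * min (t : ℝ) (rsmDelta2 p s n ε C₅)} ≤
      ENNReal.ofReal (ε / 16) := by
  refine (measure_mono fun E hE => ?_).trans ((measure_rsm_error_le h hs hsp hn hP hest ht ht0 htΔ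
    hθ hv).trans (ENNReal.ofReal_le_ofReal (rsmEta_le hn h.ε_pos h.C₅_pos htΔ)))
  rw [Set.mem_ofPred_eq] at hE ⊢
  by_contra! hlt
  have h1 := rsm_threshold_lt h hs hsp hn hρ t
  have h2 := mul_le_mul_of_nonneg_left (sqnorm_le_two_mul_add
    (est t (fun (i : Fin t) (j : Fin p) => Zb p n (θ + E) i j) (rsmEta p s n ε C₅ t)) v)
    (Nat.cast_nonneg (α := ℝ) t)
  linarith

end Detection

section Risk

lemma integral_le_of_measure_le {Ω : Type*} [MeasurableSpace Ω] {P : Measure Ω}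
    [IsProbabilityMeasure P] {φ : Ω → ℝ} {S : Set Ω} {b : ℝ} (hb : 0 ≤ b)
    (h1 : ∀ ω, φ ω ≤ 1) (h0 : ∀ ω ∉ S, φ ω ≤ 0) (hS : P S ≤ ENNReal.ofReal b) :
    ∫ ω, φ ω ∂P ≤ b := by
  by_cases hφ : Integrable φ P
  · have hm : MeasurableSet (toMeasurable P S) := measurableSet_toMeasurable P S
    calc ∫ ω, φ ω ∂P ≤ ∫ ω, (toMeasurable P S).indicator 1 ω ∂P := by
          refine integral_mono hφ ((integrable_const (1 : ℝ)).indicator hm) fun ω => ?_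
          by_cases hω : ω ∈ toMeasurable P S
          · simpa [hω] using h1 ω
          · simpa [hω] using h0 ω fun h => hω (subset_toMeasurable P S h)
      _ = P.real (toMeasurable P S) := integral_indicator_one hm
      _ ≤ b := by
          rw [Measure.real, measure_toMeasurable]
          exact ENNReal.toReal_le_of_le_ofReal hb hS
  · rwa [integral_undef hφ]

lemma biSup_le_of_nonneg {ι : Type*} {S : Set ι} {f : ι → ℝ} {b : ℝ} (hb : 0 ≤ b)
    (h : ∀ i ∈ S, f i ≤ b) : ⨆ i ∈ S, f i ≤ b :=
  Real.iSup_le (fun i => Real.iSup_le (h i) hb) hb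

variable {p n s : ℕ} {α K ε C₁ C₂ C₄ C₅ : ℝ} {P : Measure (Fin n → Fin p → ℝ)}
  {θ : Fin n → Fin p → ℝ} {est : (m : ℕ) → (Fin m → Fin p → ℝ) → ℝ → Fin p → ℝ}

/-- The set of noise arrays for which the sparse test rejects at scale `t`. -/
def rejectAt (p n s : ℕ) (est : (m : ℕ) → (Fin m → Fin p → ℝ) → ℝ → Fin p → ℝ)
    (α ε C₂ C₄ C₅ : ℝ) (θ : Fin n → Fin p → ℝ) (t : ℕ) : Set (Fin n → Fin p → ℝ) :=
  {E | ((t : ℝ) ≤ rsmDelta1 p s ε C₅ ∧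
      C₄ * (if t = 1 then (s : ℝ) * ((p : ℝ) / (s : ℝ)) ^ ((2 : ℝ) / α)
        else Real.sqrt ((s : ℝ) * Real.log (rsmDelta1 p s ε C₅))) <
        Ata p n (θ + E) t (rsmA p s α ε 1 C₅)) ∨
    (rsmDelta1 p s ε C₅ < (t : ℝ) ∧
      2 * C₂ / C₅ * min (t : ℝ) (rsmDelta2 p s n ε C₅) < (t : ℝ) * sqnorm p
        (est t (fun (i : Fin t) (j : Fin p) => Zb p n (θ + E) i j) (rsmEta p s n ε C₅ t)))}

lemma phiRSM_eq_indicator (h : IsTuned α K ε C₁ C₂ C₄ C₅) (hs : 1 ≤ s) (hsp : s ≤ p)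
    (hn : 2 ≤ n) (E : Fin n → Fin p → ℝ) :
    phiRSM p n s est α ε 1 C₄ C₅ (2 * C₂ / C₅) (θ + E) =
      (⋃ t ∈ Tgrid n, rejectAt p n s est α ε C₂ C₄ C₅ θ t).indicator 1 E := by
  have hs0 : (0 : ℝ) < s := by exact_mod_cast hs
  have hp0 : (0 : ℝ) < p := by exact_mod_cast hs.trans hsp
  have hC₄ := h.one_le_C₄
  have hC₅ := h.C₅_pos
  have hC₂ := h.C₂_pos
  have hlog := one_le_log_rsmDelta1 hs hsp h.ε_pos h.ε_lt_one h.sixteen_le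
  have h1 : 2 * C₅ ≤ rsmDelta1 p s ε C₅ := by
    linarith [le_rsmDelta1 (p := p) (s := s) hs hsp h.ε_pos h.ε_lt_one hC₅.le]
  have h2 := h1.trans (rsmDelta1_le_rsmDelta2 hn h.ε_pos hC₅.le)
  have hr : ∀ t : ℕ, 0 < C₄ * (if t = 1 then (s : ℝ) * ((p : ℝ) / (s : ℝ)) ^ ((2 : ℝ) / α)
      else Real.sqrt ((s : ℝ) * Real.log (rsmDelta1 p s ε C₅))) := fun t => by
    split_ifs <;> positivity
  have hr' : ∀ t : ℕ, rsmDelta1 p s ε C₅ < t →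
      0 < 2 * C₂ / C₅ * min (t : ℝ) (rsmDelta2 p s n ε C₅) := fun t ht => by
    have : 0 < min (t : ℝ) (rsmDelta2 p s n ε C₅) := lt_min (by linarith) (by linarith)
    positivity
  classical
  rw [phiRSM, Set.indicator_apply]
  refine if_congr ?_ rfl rfl
  simp only [Set.mem_iUnion, exists_prop, rejectAt, Set.mem_ofPred_eq, ← exists_or, ← and_or_left]
  refine exists_congr fun t => and_congr_right fun _ => or_congr ?_ ?_
  · rw [one_lt_div (hr t)]
  · refine and_congr_right fun ht => ?_
    rw [one_lt_div (hr' t ht), rsmEta]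

/-- A bound on the probability of false rejection at scale `2 ^ k`. -/
noncomputable def nullBound (p n s : ℕ) (α K ε C₄ C₅ : ℝ) (k : ℕ) : ℝ :=
  (if k = 0 then foldedMoment α K / C₄ else 0) +
  (if k ≠ 0 ∧ (2 : ℝ) ^ k ≤ rsmDelta1 p s ε C₅ then
    foldedMoment α K ^ 2 / C₄ ^ 2 / Real.log (rsmDelta1 p s ε C₅) else 0) +
  Real.exp ((s : ℝ) * Real.log (Real.exp 1 * (p : ℝ) / (s : ℝ))) *
    (if rsmDelta1 p s ε C₅ < (2 : ℝ) ^ k then Real.exp (-((2 : ℝ) ^ k / C₅)) else 0) +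
  ε / (16 * Real.log (2 * (n : ℝ)))

lemma nullBound_nonneg (h : IsTuned α K ε C₁ C₂ C₄ C₅) (hs : 1 ≤ s) (hsp : s ≤ p)
    (hn : 2 ≤ n) (k : ℕ) : 0 ≤ nullBound p n s α K ε C₄ C₅ k := by
  have hC₄ := h.one_le_C₄
  have hM := foldedMoment_nonneg (α := α) h.K_pos
  have hε := h.ε_pos
  have hlog := one_le_log_rsmDelta1 hs hsp h.ε_pos h.ε_lt_one h.sixteen_le
  have hlog' := one_le_log_two_mul hn
  unfold nullBound
  have h1 : 0 ≤ (if k = 0 then foldedMoment α K / C₄ else 0) := by split_ifs <;> positivity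
  have h2 : 0 ≤ (if k ≠ 0 ∧ (2 : ℝ) ^ k ≤ rsmDelta1 p s ε C₅ then
      foldedMoment α K ^ 2 / C₄ ^ 2 / Real.log (rsmDelta1 p s ε C₅) else 0) := by
    split_ifs <;> positivity
  have h3 : 0 ≤ (if rsmDelta1 p s ε C₅ < (2 : ℝ) ^ k then
      Real.exp (-((2 : ℝ) ^ k / C₅)) else 0) := by
    split_ifs <;> positivity
  positivity

lemma sum_nullBound_le (h : IsTuned α K ε C₁ C₂ C₄ C₅) (hs : 1 ≤ s) (hsp : s ≤ p)
    (hn : 2 ≤ n) :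
    ∑ k ∈ Finset.range (Nat.log 2 (n / 2) + 1), nullBound p n s α K ε C₄ C₅ k ≤ ε / 2 := by
  have hC₄ := h.one_le_C₄
  have hC₅ := h.C₅_pos
  have hM := foldedMoment_nonneg (α := α) h.K_pos
  have hε := h.ε_pos
  have hlog := one_le_log_rsmDelta1 hs hsp h.ε_pos h.ε_lt_one h.sixteen_le
  have hlog' := one_le_log_two_mul hn
  have hΔ : C₅ * 2 ≤ rsmDelta1 p s ε C₅ := le_rsmDelta1 hs hsp h.ε_pos h.ε_lt_one hC₅.le
  have hscale : (∑ k ∈ Finset.range (Nat.log 2 (n / 2) + 1),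
      if k = 0 then foldedMoment α K / C₄ else 0) ≤ ε / 16 := by
    simpa using h.moment_div_le
  have hcross : (∑ k ∈ Finset.range (Nat.log 2 (n / 2) + 1),
      if k ≠ 0 ∧ (2 : ℝ) ^ k ≤ rsmDelta1 p s ε C₅ then
        foldedMoment α K ^ 2 / C₄ ^ 2 / Real.log (rsmDelta1 p s ε C₅) else 0) ≤ ε / 16 := by
    rw [← Finset.sum_filter, Finset.sum_const, nsmul_eq_mul]
    refine (mul_le_mul_of_nonneg_right (card_dyadic_le _ (by linarith [h.sixteen_le]))
      (by positivity)).trans (le_of_eq_of_le ?_ h.two_mul_moment_sq_div_le)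
    field_simp
  have hrsm : Real.exp ((s : ℝ) * Real.log (Real.exp 1 * (p : ℝ) / (s : ℝ))) *
      (∑ k ∈ Finset.range (Nat.log 2 (n / 2) + 1),
        if rsmDelta1 p s ε C₅ < (2 : ℝ) ^ k then Real.exp (-((2 : ℝ) ^ k / C₅)) else 0) ≤
      ε / 8 := by
    refine (mul_le_mul_of_nonneg_left (sum_exp_dyadic_le hC₅ (by linarith) _)
      (Real.exp_pos _).le).trans_eq ?_
    have hdiv : -(rsmDelta1 p s ε C₅ / C₅) =
        -((s : ℝ) * Real.log (Real.exp 1 * (p : ℝ) / (s : ℝ))) - Real.log (16 / ε) := by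
      rw [rsmDelta1, mul_div_cancel_left₀ _ hC₅.ne']
      ring
    rw [hdiv, mul_left_comm, ← Real.exp_add, add_sub_assoc', add_neg_cancel, zero_sub,
      Real.exp_neg, Real.exp_log (by positivity)]
    field_simp
    norm_num
  have hrest : (∑ _k ∈ Finset.range (Nat.log 2 (n / 2) + 1),
      ε / (16 * Real.log (2 * (n : ℝ)))) ≤ ε / 8 := by
    rw [Finset.sum_const, Finset.card_range, nsmul_eq_mul]
    refine (mul_le_mul_of_nonneg_right (log_half_add_one_le hn) (by positivity)).trans_eq ?_
    field_simp
    norm_num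
  simp only [nullBound, Finset.sum_add_distrib, ← Finset.mul_sum]
  linarith

lemma pow_le_half {k : ℕ} (hn : 2 ≤ n) (hk : k < Nat.log 2 (n / 2) + 1) : 2 ^ k ≤ n / 2 :=
  (Nat.pow_le_pow_right two_pos (Nat.lt_succ_iff.1 hk)).trans
    (Nat.pow_log_le_self 2 (by omega))

lemma measure_rejectAt_null_le (h : IsTuned α K ε C₁ C₂ C₄ C₅) (hs : 1 ≤ s) (hsp : s ≤ p)
    (hn : 2 ≤ n) (hP : P ∈ Pclass p n α K) (hest : CondRSM p s α K C₁ C₂ est)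
    (hθ : θ ∈ Theta0 p n) {k : ℕ} (hk : k < Nat.log 2 (n / 2) + 1) :
    P (rejectAt p n s est α ε C₂ C₄ C₅ θ (2 ^ k)) ≤
      ENNReal.ofReal (nullBound p n s α K ε C₄ C₅ k) := by
  have hkn := pow_le_half hn hk
  have hk0 : 0 < 2 ^ k := by positivity
  have hZ : ∀ i < 2 ^ k, ∀ j, Zb p n θ i j = 0 := fun i hi j =>
    Zb_eq_zero_of_mem_Theta0 hθ (hi.trans_le hkn) j
  have hε := h.ε_pos
  have hlog' := one_le_log_two_mul hn
  have hrest : 0 ≤ ε / (16 * Real.log (2 * (n : ℝ))) := by positivity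
  have hC₄ := h.one_le_C₄
  have hM := foldedMoment_nonneg (α := α) h.K_pos
  rcases le_or_gt ((2 : ℝ) ^ k) (rsmDelta1 p s ε C₅) with hΔ | hΔ
  · rcases Nat.eq_zero_or_pos k with rfl | hkp
    · refine (measure_mono fun E hE => ?_).trans ((measure_Ata_one_null_le h hs hsp hn hP
        (hZ 0 hk0)).trans (ENNReal.ofReal_le_ofReal ?_))
      · rcases hE with hE | hE
        · simpa using hE.2
        · exact absurd hE.1 (by push_cast; exact hΔ.not_gt)
      · simp only [nullBound, if_true, ne_eq, not_true_eq_false, false_and, if_false,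
          if_neg hΔ.not_gt]
        linarith
    · have hne : k ≠ 0 := hkp.ne'
      have h1 : 2 ^ k ≠ 1 := (Nat.one_lt_two_pow hne).ne'
      refine (measure_mono fun E hE => ?_).trans ((measure_Ata_null_le h hs hsp hP hkn
        (even_two.pow_of_ne_zero hne) hk0 hZ).trans (ENNReal.ofReal_le_ofReal ?_))
      · rcases hE with hE | hE
        · rw [Set.mem_ofPred_eq]
          simpa only [if_neg h1] using hE.2
        · exact absurd hE.1 (by push_cast; exact hΔ.not_gt)
      · simp only [nullBound, if_neg hne, if_pos (And.intro hne hΔ), if_neg hΔ.not_gt]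
        linarith
  · have hkne : k ≠ 0 ∧ (2 : ℝ) ^ k ≤ rsmDelta1 p s ε C₅ → False := fun h => h.2.not_gt hΔ
    have hΔ' : rsmDelta1 p s ε C₅ < ((2 ^ k : ℕ) : ℝ) := by exact_mod_cast hΔ
    refine (measure_mono fun E hE => ?_).trans ((measure_rsm_error_le h hs hsp hn hP hest hkn hk0
      hΔ' (v := 0) hZ (by simp [l0])).trans (ENNReal.ofReal_le_ofReal
        ((rsmEta_le_add hn hε h.C₅_pos).trans ?_)))
    · rcases hE with hE | hE
      · exact absurd hE.1 hΔ'.not_ge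
      · rw [Set.mem_ofPred_eq]
        simpa only [Pi.zero_apply, sub_zero] using hE.2
    · simp only [nullBound, if_pos hΔ, if_neg hkne]
      push_cast
      have : 0 ≤ (if k = 0 then foldedMoment α K / C₄ else 0) := by split_ifs <;> positivity
      linarith

lemma type_one_error_le (h : IsTuned α K ε C₁ C₂ C₄ C₅) (hs : 1 ≤ s) (hsp : s ≤ p)
    (hn : 2 ≤ n) (hP : P ∈ Pclass p n α K) (hest : CondRSM p s α K C₁ C₂ est)
    (hθ : θ ∈ Theta0 p n) :
    ∫ E, phiRSM p n s est α ε 1 C₄ C₅ (2 * C₂ / C₅) (θ + E) ∂P ≤ ε / 2 := by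
  have := isProbabilityMeasure_of_mem_Pclass hP
  have hε := h.ε_pos
  simp only [phiRSM_eq_indicator h hs hsp hn]
  refine integral_le_of_measure_le (S := ⋃ t ∈ Tgrid n, rejectAt p n s est α ε C₂ C₄ C₅ θ t)
    (by positivity) (fun E => Set.indicator_le_self' (by simp) E)
    (fun E hE => (Set.indicator_of_notMem hE _).le) ?_
  rw [Tgrid, Finset.set_biUnion_finset_image]
  refine (measure_biUnion_finset_le _ _).trans ((Finset.sum_le_sum fun k hk =>
    measure_rejectAt_null_le h hs hsp hn hP hest hθ (Finset.mem_range.1 hk)).trans ?_)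
  rw [← ENNReal.ofReal_sum_of_nonneg fun k _ => nullBound_nonneg h hs hsp hn k]
  exact ENNReal.ofReal_le_ofReal (sum_nullBound_le h hs hsp hn)

lemma measure_compl_rejectAt_le (h : IsTuned α K ε C₁ C₂ C₄ C₅) (hs : 1 ≤ s) (hsp : s ≤ p)
    (hn : 2 ≤ n) (hP : P ∈ Pclass p n α K) (hest : CondRSM p s α K C₁ C₂ est) {ρ : ℝ}
    (hρ : C₅ * ((s : ℝ) * ((p : ℝ) / (s : ℝ)) ^ ((2 : ℝ) / α) + LL n) ≤ ρ ^ 2)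
    {t : ℕ} (htT : t ∈ Tgrid n) (ht : t ≤ n / 2) (ht0 : 0 < t)
    {v : Fin p → ℝ} (hθ : ∀ k < t, ∀ j, Zb p n θ k j = v j) (hv : l0 p v ≤ s)
    (hvρ : ρ ^ 2 ≤ 4 * (t * sqnorm p v)) :
    P (rejectAt p n s est α ε C₂ C₄ C₅ θ t)ᶜ ≤ ENNReal.ofReal (ε / 2) := by
  have hε := h.ε_pos
  rcases le_or_gt (t : ℝ) (rsmDelta1 p s ε C₅) with hΔ | hΔ
  · rcases eq_or_ne t 1 with rfl | ht1
    · refine (measure_mono fun E hE => ?_).trans ((measure_Ata_one_alt_le h hs hsp hn hP hρ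
        (hθ 0 ht0) hv (by simpa using hvρ)).trans (ENNReal.ofReal_le_ofReal (by linarith)))
      rw [Set.mem_ofPred_eq]
      refine not_lt.1 fun hlt => hE (Or.inl ⟨hΔ, ?_⟩)
      simpa using hlt
    · obtain ⟨k, -, rfl⟩ := Finset.mem_image.1 htT
      have hk : k ≠ 0 := fun hk => ht1 (by rw [hk, pow_zero])
      refine (measure_mono fun E hE => ?_).trans ((measure_Ata_alt_le h hs hsp hn hP hρ ht
        (even_two.pow_of_ne_zero hk) ht0 hθ hv hvρ).trans
          (ENNReal.ofReal_le_ofReal (by linarith)))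
      rw [Set.mem_ofPred_eq]
      refine not_lt.1 fun hlt => hE (Or.inl ⟨hΔ, ?_⟩)
      simpa only [if_neg ht1] using hlt
  · refine (measure_mono fun E hE => ?_).trans ((measure_rsm_alt_le h hs hsp hn hP hest hρ ht ht0
      hΔ hθ hv hvρ).trans (ENNReal.ofReal_le_ofReal (by linarith)))
    rw [Set.mem_ofPred_eq]
    exact not_lt.1 fun hlt => hE (Or.inr ⟨hΔ, hlt⟩)

lemma type_two_error_le (h : IsTuned α K ε C₁ C₂ C₄ C₅) (hs : 1 ≤ s) (hsp : s ≤ p)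
    (hn : 2 ≤ n) (hP : P ∈ Pclass p n α K) (hest : CondRSM p s α K C₁ C₂ est) {ρ : ℝ}
    (hρ : C₅ * ((s : ℝ) * ((p : ℝ) / (s : ℝ)) ^ ((2 : ℝ) / α) + LL n) ≤ ρ ^ 2)
    (hθ : θ ∈ Theta1 p n s ρ) :
    ∫ E, (1 - phiRSM p n s est α ε 1 C₄ C₅ (2 * C₂ / C₅) (θ + E)) ∂P ≤ ε / 2 := by
  have := isProbabilityMeasure_of_mem_Pclass hP
  have hε := h.ε_pos
  simp only [Theta1, Set.mem_iUnion, Finset.mem_Icc, exists_prop] at hθ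
  obtain ⟨t0, ⟨h1, h2⟩, hθ⟩ := hθ
  obtain ⟨t, htT, ht0, ht, v, hZ, hv, hvρ⟩ := exists_shift_of_mem_ThetaAt hn h1 h2 hθ
  simp only [phiRSM_eq_indicator h hs hsp hn]
  refine integral_le_of_measure_le (by positivity) (fun E => ?_) (fun E hE => ?_)
    (measure_compl_rejectAt_le h hs hsp hn hP hest hρ htT ht ht0 hZ hv hvρ)
  · exact sub_le_self _ (Set.indicator_nonneg (fun _ _ => zero_le_one) E)
  · rw [Set.indicator_of_mem (Set.mem_iUnion₂_of_mem htT (Set.notMem_compl_iff.1 hE)), Pi.one_apply,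
      sub_self]

end Risk

end Helpers

/-- Theorem: sparse testing via a robust sparse mean estimator. -/
theorem statement_4 (α K ε C₁ C₂ : ℝ) (hα : 4 ≤ α) (hK : 0 < K)
    (hε0 : 0 < ε) (hε1 : ε < 1) (hC₁ : 1 ≤ C₁) (hC₂ : 1 ≤ C₂) :
    ∃ C₃ C₄ C₅ C₆ : ℝ, 0 < C₃ ∧ 0 < C₄ ∧ 0 < C₅ ∧ 0 < C₆ ∧
      ∀ p n s : ℕ, 0 < p → 2 ≤ n → 1 ≤ s → s ≤ p →
        ∀ est : (m : ℕ) → (Fin m → Fin p → ℝ) → ℝ → Fin p → ℝ,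
          CondRSM p s α K C₁ C₂ est →
          ∀ ρ : ℝ,
            C₅ * ((s : ℝ) * ((p : ℝ) / (s : ℝ)) ^ ((2 : ℝ) / α) + LL n) ≤ ρ ^ 2 →
            risk p n (Pclass p n α K) (Theta1 p n s ρ)
              (phiRSM p n s est α ε C₃ C₄ C₅ C₆) ≤ ε := by
  obtain ⟨C₄, C₅, h⟩ := exists_isTuned hα hK hε0 hε1 (C₁ := C₁) (C₂ := C₂)
    (by linarith) (by linarith)
  have hC₅ := h.C₅_pos
  refine ⟨1, C₄, C₅, 2 * C₂ / C₅, one_pos, by linarith [h.one_le_C₄], hC₅, by positivity, ?_⟩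
  intro p n s _ hn hs hsp est hest ρ hρ
  have hε : 0 ≤ ε / 2 := by positivity
  refine (add_le_add
    (biSup_le_of_nonneg hε fun P hP => biSup_le_of_nonneg hε fun θ hθ =>
      type_one_error_le h hs hsp hn hP hest hθ)
    (biSup_le_of_nonneg hε fun P hP => biSup_le_of_nonneg hε fun θ hθ =>
      type_two_error_le h hs hsp hn hP hest hρ hθ)).trans_eq (add_halves ε)

end ChangePoint
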